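/- Let T > 0 satisfy T² < (3/2)·π². Then there exists n₀ ∈ ℕ such that for every odd n ≥ n₀ the following holds. Let x* : ℝ → ℝ be a twice differentiable solution of the double-well Duffing equation x*''(t) − x*(t) + x*(t)³ = 0 with strictly positive energy and minimal period 2T/n (so that x*(t − T) = −x*(t) and x* solves the delayed Duffing equation x''(t) + x(t − T) + x(t)³ = 0). Let Γ = {(x*(s), x*'(s)) : s ∈ ℝ} ⊆ ℝ². Then x* is locally asymptotically stable as a periodic orbit of the delayed Duffing equation: for every δ > 0 there exists ε > 0 such that for every continuously differentiable y : [−T, ∞) → ℝ that is twice differentiable on (0, ∞) with y''(t) + y(t − T) + y(t)³ = 0 for all t > 0, if there exists θ ∈ ℝ with sup_{s ∈ [−T, 0]} (|y(s) − x*(s + θ)| + |y'(s) − x*'(s + θ)|) < ε, then dist((y(t), y'(t)), Γ) < δ for all t ≥ 0, and dist((y(t), y'(t)), Γ) → 0 as t → ∞. -/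

import Mathlib

open Filter

/-- The integral of `f` over the window of length `T` ending at `t`. -/
noncomputable def slidingIntegral (T : ℝ) (f : ℝ → ℝ) (t : ℝ) : ℝ := ∫ s in (t - T)..t, f s

lemma hasDerivAt_slidingIntegral (T : ℝ) {f : ℝ → ℝ} (hf : Continuous f) (t : ℝ) :
    HasDerivAt (slidingIntegral T f) (f t - f (t - T)) t := by
  have h0 : ∀ u : ℝ, HasDerivAt (fun u => ∫ s in (0:ℝ)..u, f s) (f u) u := fun u =>
    intervalIntegral.integral_hasDerivAt_right (hf.intervalIntegrable _ _)
      hf.stronglyMeasurable.stronglyMeasurableAtFilter hf.continuousAt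
  have h1 : HasDerivAt (fun u => ∫ s in (0:ℝ)..(u - T), f s) (f (t - T)) t := by
    have := (h0 (t - T)).comp t ((hasDerivAt_id t).sub_const T)
    simpa [Function.comp_def] using this
  refine ((h0 t).sub h1).congr_of_eventuallyEq (Eventually.of_forall fun u => ?_)
  simp only [slidingIntegral, Pi.sub_apply]
  rw [intervalIntegral.integral_interval_sub_left] <;> exact hf.intervalIntegrable _ _

lemma continuous_slidingIntegral (T : ℝ) {f : ℝ → ℝ} (hf : Continuous f) :
    Continuous (slidingIntegral T f) :=
  continuous_iff_continuousAt.2 fun t => (hasDerivAt_slidingIntegral T hf t).continuousAt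

lemma sub_le_integral_of_deriv_le {F F' g : ℝ → ℝ} {a b : ℝ} (hab : a ≤ b)
    (hF : ContinuousOn F (Set.Icc a b)) (hg : ContinuousOn g (Set.Icc a b))
    (hderiv : ∀ t ∈ Set.Ioo a b, HasDerivAt F (F' t) t)
    (hle : ∀ t ∈ Set.Ioo a b, F' t ≤ g t) : F b - F a ≤ ∫ t in a..b, g t :=
  intervalIntegral.sub_le_integral_of_hasDeriv_right_of_le hab hF
    (fun t ht => (hderiv t ht).hasDerivWithinAt) hg.integrableOn_Icc hle

lemma sq_integral_le {g : ℝ → ℝ} (hg : Continuous g) {a b : ℝ} (hab : a ≤ b) :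
    (∫ t in a..b, g t) ^ 2 ≤ (b - a) * ∫ t in a..b, g t ^ 2 := by
  rcases hab.eq_or_lt with rfl | hlt
  · simp
  set m := (∫ t in a..b, g t) with hm
  have h : 0 ≤ ∫ t in a..b, ((b - a) * g t - m) ^ 2 :=
    intervalIntegral.integral_nonneg hab fun t _ => sq_nonneg _
  have e : (∫ t in a..b, ((b - a) * g t - m) ^ 2)
      = (b - a) ^ 2 * (∫ t in a..b, g t ^ 2) - 2 * (b - a) * m * m + (b - a) * m ^ 2 := by
    have : ∀ t, ((b - a) * g t - m) ^ 2
        = (b - a) ^ 2 * g t ^ 2 - 2 * (b - a) * m * g t + m ^ 2 := fun t => by ring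
    simp only [this]
    rw [intervalIntegral.integral_add, intervalIntegral.integral_sub,
      intervalIntegral.integral_const_mul, intervalIntegral.integral_const_mul,
      intervalIntegral.integral_const, ← hm, smul_eq_mul]
    all_goals exact Continuous.intervalIntegrable (by fun_prop) _ _
  rw [e] at h
  have h2 : 0 ≤ (b - a) * ((b - a) * (∫ t in a..b, g t ^ 2) - m ^ 2) := by linarith
  have := nonneg_of_mul_nonneg_right h2 (sub_pos.2 hlt)
  linarith

/-- Picone's identity with the positive solution `cos (ω (t - m))` of `φ'' = -ω² φ`. -/
lemma sub_le_integral_of_cos_pos {f f' g : ℝ → ℝ} {ω m a b : ℝ} (hab : a ≤ b)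
    (hf : ContinuousOn f (Set.Icc a b)) (hg : ContinuousOn g (Set.Icc a b))
    (hderiv : ∀ t ∈ Set.Ioo a b, HasDerivAt f (f' t) t)
    (hle : ∀ t ∈ Set.Ioo a b, f' t ^ 2 ≤ g t)
    (hpos : ∀ t ∈ Set.Icc a b, 0 < Real.cos (ω * (t - m))) :
    -(ω * Real.tan (ω * (b - m)) * f b ^ 2) + ω * Real.tan (ω * (a - m)) * f a ^ 2
      ≤ ∫ t in a..b, (g t - ω ^ 2 * f t ^ 2) := by
  have hsub := Set.Ioo_subset_Icc_self (a := a) (b := b)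
  have key := sub_le_integral_of_deriv_le (F := fun t => -(ω * Real.tan (ω * (t - m)) * f t ^ 2))
    (F' := fun t => -(ω * (1 / Real.cos (ω * (t - m)) ^ 2 * ω) * f t ^ 2
        + ω * Real.tan (ω * (t - m)) * (2 * f t * f' t)))
    (g := fun t => g t - ω ^ 2 * f t ^ 2) hab ?_ ?_ ?_ ?_
  · linarith
  · have : ContinuousOn (fun t => Real.tan (ω * (t - m))) (Set.Icc a b) := fun t ht =>
      ((Real.continuousAt_tan.2 (hpos t ht).ne').comp
        (f := fun t => ω * (t - m)) (by fun_prop)).continuousWithinAt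
    fun_prop
  · fun_prop
  · intro t ht
    have h1 : HasDerivAt (fun t => Real.tan (ω * (t - m)))
        (1 / Real.cos (ω * (t - m)) ^ 2 * ω) t := by
      have h2 : HasDerivAt (fun t : ℝ => ω * (t - m)) ω t := by
        simpa using ((hasDerivAt_id t).sub_const m).const_mul ω
      exact (Real.hasDerivAt_tan (hpos t (hsub ht)).ne').comp t h2
    have h3 := ((h1.const_mul ω).mul ((hderiv t ht).pow 2)).neg
    refine h3.congr_deriv ?_
    simp
  · intro t ht
    have hc := (hpos t (hsub ht)).ne'
    have h1 := hle t ht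
    have h2 : 1 / Real.cos (ω * (t - m)) ^ 2 = 1 + Real.tan (ω * (t - m)) ^ 2 := by
      rw [Real.tan_eq_sin_div_cos]; field_simp
      linarith [Real.sin_sq_add_cos_sq (ω * (t - m))]
    simp only [h2]
    nlinarith [sq_nonneg (f' t + ω * Real.tan (ω * (t - m)) * f t)]

/-- Wirtinger's inequality for functions with antiperiodic boundary values. -/
lemma wirtinger_antiperiodic {f f' g : ℝ → ℝ} {ω T a : ℝ} (hω : 0 < ω) (hT : 0 < T)
    (hωT : ω * T < Real.pi) (hf : Continuous f) (hg : Continuous g)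
    (hderiv : ∀ t ∈ Set.Ioo a (a + T), HasDerivAt f (f' t) t)
    (hle : ∀ t ∈ Set.Ioo a (a + T), f' t ^ 2 ≤ g t) (hanti : f (a + T) = -f a) :
    ω ^ 2 * (∫ t in a..(a + T), f t ^ 2) ≤ ∫ t in a..(a + T), g t := by
  obtain ⟨z, hz, hfz⟩ : ∃ z ∈ Set.Icc a (a + T), f z = 0 := by
    have haT : a ≤ a + T := by linarith
    rcases le_total (f a) 0 with h | h
    · exact intermediate_value_Icc haT hf.continuousOn ⟨h, by rw [hanti]; linarith⟩
    · exact intermediate_value_Icc' haT hf.continuousOn ⟨by rw [hanti]; linarith, h⟩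
  have hcos : ∀ u : ℝ, |u| ≤ T / 2 → 0 < Real.cos (ω * u) := by
    intro u hu
    obtain ⟨h1, h2⟩ := abs_le.1 hu
    apply Real.cos_pos_of_mem_Ioo
    constructor <;> nlinarith
  have k1 := sub_le_integral_of_cos_pos (m := z - T / 2) hz.1 hf.continuousOn hg.continuousOn
    (fun t ht => hderiv t ⟨ht.1, ht.2.trans_le hz.2⟩)
    (fun t ht => hle t ⟨ht.1, ht.2.trans_le hz.2⟩)
    (fun t ht => hcos _ (abs_le.2 ⟨by linarith [ht.1, hz.2], by linarith [ht.2]⟩))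
  have k2 := sub_le_integral_of_cos_pos (m := z + T / 2) hz.2 hf.continuousOn hg.continuousOn
    (fun t ht => hderiv t ⟨hz.1.trans_lt ht.1, ht.2⟩)
    (fun t ht => hle t ⟨hz.1.trans_lt ht.1, ht.2⟩)
    (fun t ht => hcos _ (abs_le.2 ⟨by linarith [ht.1], by linarith [ht.2, hz.1]⟩))
  have hsum : (∫ t in a..z, (g t - ω ^ 2 * f t ^ 2)) + (∫ t in z..(a + T), (g t - ω ^ 2 * f t ^ 2))
      = (∫ t in a..(a + T), g t) - ω ^ 2 * ∫ t in a..(a + T), f t ^ 2 := by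
    rw [intervalIntegral.integral_add_adjacent_intervals, intervalIntegral.integral_sub,
      intervalIntegral.integral_const_mul]
    all_goals exact Continuous.intervalIntegrable (by fun_prop) _ _
  have e : a + T - (z + T / 2) = a - (z - T / 2) := by ring
  rw [hfz] at k1 k2
  rw [hanti, e] at k2
  nlinarith

/-- `v` solves `v' = -κ ∫_{t-T}^t v` on `(a, b)` up to a defect `μ`, and is bounded by one. -/
structure IsApproxSolution (κ T μ : ℝ) (v v' : ℝ → ℝ) (a b : ℝ) : Prop where
  continuous : Continuous v
  abs_le_one : ∀ t ∈ Set.Icc (a - T) b, |v t| ≤ 1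
  hasDerivAt : ∀ t ∈ Set.Ioo a b, HasDerivAt v (v' t) t
  defect_le : ∀ t ∈ Set.Ioo a b, |v' t + κ * slidingIntegral T v t| ≤ μ

/-- The Lyapunov functional of `v' = -κ ∫_{t-T}^t v` whose derivative is `-(v' + v'(· - T))² / 2`. -/
noncomputable def sumFunctional (κ T : ℝ) (v : ℝ → ℝ) (t : ℝ) : ℝ :=
  κ ^ 2 / 2 * slidingIntegral T (fun s => slidingIntegral T v s ^ 2) t
    - κ * slidingIntegral T (fun s => v s ^ 2) t
    + κ * slidingIntegral T v t * (v t + v (t - T))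

/-- The functional along which the antiperiodic component of `v'` is dissipated. -/
noncomputable def diffFunctional (κ T : ℝ) (v : ℝ → ℝ) (t : ℝ) : ℝ :=
  κ ^ 2 / 2 * slidingIntegral T (fun s => slidingIntegral T v s ^ 2) t
    + κ * slidingIntegral T v t * (v t - v (t - T))

namespace IsApproxSolution

variable {κ T μ a b : ℝ} {v v' : ℝ → ℝ}

lemma mono (h : IsApproxSolution κ T μ v v' a b) {a' b' : ℝ} (ha : a ≤ a') (hb : b' ≤ b) :
    IsApproxSolution κ T μ v v' a' b' where
  continuous := h.continuous
  abs_le_one t ht := h.abs_le_one t ⟨by linarith [ht.1], by linarith [ht.2]⟩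
  hasDerivAt t ht := h.hasDerivAt t ⟨by linarith [ht.1], by linarith [ht.2]⟩
  defect_le t ht := h.defect_le t ⟨by linarith [ht.1], by linarith [ht.2]⟩

lemma continuous_sliding (h : IsApproxSolution κ T μ v v' a b) :
    Continuous (slidingIntegral T v) := continuous_slidingIntegral T h.continuous

lemma abs_sliding_le (h : IsApproxSolution κ T μ v v' a b) (hT : 0 ≤ T) {t : ℝ}
    (ht : t ∈ Set.Icc a b) : |slidingIntegral T v t| ≤ T := by
  have := intervalIntegral.norm_integral_le_of_norm_le_const (a := t - T) (b := t) (f := v)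
    (C := 1) (fun s hs => by
      rw [Set.uIoc_of_le (by linarith)] at hs
      exact h.abs_le_one s ⟨by linarith [hs.1, ht.1], by linarith [hs.2, ht.2]⟩)
  simpa [slidingIntegral, abs_of_nonneg hT] using this

lemma deriv_sq_le (h : IsApproxSolution κ T μ v v' a b) (hT : 0 ≤ T) (hκ : 0 ≤ κ) (hμ1 : μ ≤ 1)
    {t : ℝ} (ht : t ∈ Set.Ioo a b) :
    v' t ^ 2 ≤ κ ^ 2 * slidingIntegral T v t ^ 2 + (2 * κ * T + 1) * μ := by
  have h1 := abs_le.1 (h.defect_le t ht)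
  have h2 := abs_le.1 (h.abs_sliding_le hT (Set.Ioo_subset_Icc_self ht))
  set e := v' t + κ * slidingIntegral T v t with he
  have hv : v' t = e - κ * slidingIntegral T v t := by rw [he]; ring
  have h3 : -(T * μ) ≤ slidingIntegral T v t * e := by
    have := abs_mul (slidingIntegral T v t) e
    have h4 : |slidingIntegral T v t| * |e| ≤ T * μ :=
      mul_le_mul (abs_le.2 h2) (abs_le.2 h1) (abs_nonneg _) hT
    rw [← this] at h4
    exact (abs_le.1 h4).1
  have h5 : e ^ 2 ≤ μ := by nlinarith
  rw [hv]
  nlinarith [mul_le_mul_of_nonneg_left h3 hκ]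

lemma abs_sub_add_integral_le (h : IsApproxSolution κ T μ v v' a b) {s t : ℝ} (has : a ≤ s)
    (hst : s ≤ t) (htb : t ≤ b) :
    |v t - v s + κ * ∫ r in s..t, slidingIntegral T v r| ≤ μ * (t - s) := by
  have hc := h.continuous_sliding
  have hv := h.continuous
  have hIoo : ∀ r ∈ Set.Ioo s t, r ∈ Set.Ioo a b := fun r hr =>
    ⟨has.trans_lt hr.1, hr.2.trans_le htb⟩
  have k1 := sub_le_integral_of_deriv_le (F := v) (F' := v')
    (g := fun r => μ - κ * slidingIntegral T v r) hst hv.continuousOn (by fun_prop)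
    (fun r hr => h.hasDerivAt r (hIoo r hr))
    (fun r hr => by linarith [(abs_le.1 (h.defect_le r (hIoo r hr))).2])
  have k2 := sub_le_integral_of_deriv_le (F := fun r => -v r) (F' := fun r => -v' r)
    (g := fun r => μ + κ * slidingIntegral T v r) hst (by fun_prop) (by fun_prop)
    (fun r hr => (h.hasDerivAt r (hIoo r hr)).neg)
    (fun r hr => by linarith [(abs_le.1 (h.defect_le r (hIoo r hr))).1])
  rw [intervalIntegral.integral_sub, intervalIntegral.integral_const_mul,
    intervalIntegral.integral_const, smul_eq_mul] at k1
  · rw [intervalIntegral.integral_add, intervalIntegral.integral_const_mul,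
      intervalIntegral.integral_const, smul_eq_mul] at k2
    · exact abs_le.2 ⟨by linarith, by linarith⟩
    all_goals exact Continuous.intervalIntegrable (by fun_prop) _ _
  all_goals exact Continuous.intervalIntegrable (by fun_prop) _ _

lemma sq_sub_le (h : IsApproxSolution κ T μ v v' a (a + T)) (hT : 0 < T) (hμ : 0 ≤ μ)
    (hμ1 : μ ≤ 1) {t : ℝ} (ht : t ∈ Set.Icc a (a + T)) :
    (v t - v a) ^ 2 ≤ 2 * κ ^ 2 * T * slidingIntegral T (fun s => slidingIntegral T v s ^ 2) (a + T)
      + 2 * T ^ 2 * μ := by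
  have hc := h.continuous_sliding
  have h1 := h.abs_sub_add_integral_le le_rfl ht.1 ht.2
  have h2 := sq_integral_le hc ht.1
  have h3 : (∫ r in a..t, slidingIntegral T v r ^ 2)
      ≤ slidingIntegral T (fun s => slidingIntegral T v s ^ 2) (a + T) := by
    rw [slidingIntegral, add_sub_cancel_right]
    exact intervalIntegral.integral_mono_interval le_rfl ht.1 ht.2
      (Eventually.of_forall fun r => sq_nonneg _)
      (Continuous.intervalIntegrable (by fun_prop) _ _)
  have h0 : 0 ≤ ∫ r in a..t, slidingIntegral T v r ^ 2 :=
    intervalIntegral.integral_nonneg ht.1 fun r _ => sq_nonneg _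
  set A := ∫ r in a..t, slidingIntegral T v r
  set I := slidingIntegral T (fun s => slidingIntegral T v s ^ 2) (a + T)
  have h4 : A ^ 2 ≤ T * I := h2.trans
    (mul_le_mul (by linarith [ht.2]) h3 h0 hT.le)
  have h5 : μ * (t - a) ≤ μ * T := mul_le_mul_of_nonneg_left (by linarith [ht.2]) hμ
  have h6 : (v t - v a + κ * A) ^ 2 ≤ T ^ 2 * μ := by
    have : (v t - v a + κ * A) ^ 2 ≤ (μ * T) ^ 2 := sq_le_sq' (by linarith [(abs_le.1 h1).1])
      (by linarith [(abs_le.1 h1).2])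
    nlinarith [mul_nonneg (mul_nonneg hμ (sub_nonneg.2 hμ1)) (sq_nonneg T)]
  nlinarith [sq_nonneg (v t - v a + 2 * κ * A), mul_le_mul_of_nonneg_left h4 (sq_nonneg κ)]

/-- Decomposition of `v` on a window into the mean of its boundary values and a remainder with
antiperiodic boundary values, to which Wirtinger's inequality applies. -/
lemma exists_antiperiodic_part (h : IsApproxSolution κ T μ v v' a (a + T)) (hT : 0 < T)
    (hκ : 0 ≤ κ) (hμ1 : μ ≤ 1) {ω : ℝ} (hω : 0 < ω) (hωT : ω * T < Real.pi) :
    ∃ J Y : ℝ, 0 ≤ J ∧ Y ^ 2 ≤ T * J ∧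
      slidingIntegral T v (a + T) = Y + T * (v (a + T) + v a) / 2 ∧
      slidingIntegral T (fun s => v s ^ 2) (a + T)
        = J + (v (a + T) + v a) * Y + T * (v (a + T) + v a) ^ 2 / 4 ∧
      ω ^ 2 * J ≤ κ ^ 2 * slidingIntegral T (fun s => slidingIntegral T v s ^ 2) (a + T)
        + (2 * κ * T + 1) * μ * T := by
  have hc := h.continuous_sliding
  have hv := h.continuous
  set m := v (a + T) + v a with hm
  have haT : a ≤ a + T := by linarith
  refine ⟨∫ r in a..(a + T), (v r - m / 2) ^ 2, ∫ r in a..(a + T), (v r - m / 2),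
    intervalIntegral.integral_nonneg haT fun r _ => sq_nonneg _, ?_, ?_, ?_, ?_⟩
  · simpa using sq_integral_le (g := fun r => v r - m / 2) (by fun_prop) haT
  · rw [slidingIntegral, add_sub_cancel_right, intervalIntegral.integral_sub,
      intervalIntegral.integral_const, smul_eq_mul]
    · ring
    all_goals exact Continuous.intervalIntegrable (by fun_prop) _ _
  · rw [slidingIntegral, add_sub_cancel_right]
    have e : ∀ r, v r ^ 2 = (v r - m / 2) ^ 2 + (m * (v r - m / 2) + m ^ 2 / 4) := fun r => by ring
    simp only [e]
    rw [intervalIntegral.integral_add, intervalIntegral.integral_add,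
      intervalIntegral.integral_const_mul, intervalIntegral.integral_const, smul_eq_mul]
    · ring
    all_goals exact Continuous.intervalIntegrable (by fun_prop) _ _
  · have k := wirtinger_antiperiodic (f := fun r => v r - m / 2) (f' := v')
      (g := fun r => κ ^ 2 * slidingIntegral T v r ^ 2 + (2 * κ * T + 1) * μ) hω hT hωT
      (a := a) (by fun_prop) (by fun_prop) (fun r hr => (h.hasDerivAt r hr).sub_const _)
      (fun r hr => h.deriv_sq_le hT.le hκ hμ1 hr) (by simp only [hm]; ring)
    refine k.trans_eq ?_
    rw [intervalIntegral.integral_add, intervalIntegral.integral_const_mul,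
      intervalIntegral.integral_const, smul_eq_mul, slidingIntegral, add_sub_cancel_right]
    · ring
    all_goals exact Continuous.intervalIntegrable (by fun_prop) _ _

end IsApproxSolution

lemma slidingIntegral_sq_nonneg {T : ℝ} (hT : 0 ≤ T) (f : ℝ → ℝ) (t : ℝ) :
    0 ≤ slidingIntegral T (fun s => f s ^ 2) t :=
  intervalIntegral.integral_nonneg (by linarith) fun r _ => sq_nonneg _

namespace IsApproxSolution

variable {κ T μ a b : ℝ} {v v' : ℝ → ℝ}

set_option maxHeartbeats 1000000 in
lemma functional_bounds {κ T ω : ℝ} (hκ : 0 < κ) (hT : 0 < T) (hω : 0 < ω)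
    (hωT : ω * T < Real.pi) (hκω : 2 * κ < ω ^ 2) :
    ∃ c > 0, ∃ A > 0, ∀ (v v' : ℝ → ℝ) (μ a t : ℝ), 0 ≤ μ → μ ≤ 1 → t = a + T →
      IsApproxSolution κ T μ v v' a t →
      c * (slidingIntegral T (fun s => slidingIntegral T v s ^ 2) t + (v t + v (t - T)) ^ 2)
        ≤ sumFunctional κ T v t + A * μ ∧
      sumFunctional κ T v t ≤ A * (slidingIntegral T (fun s => slidingIntegral T v s ^ 2) t
        + (v t + v (t - T)) ^ 2) ∧
      |diffFunctional κ T v t| ≤ A * (slidingIntegral T (fun s => slidingIntegral T v s ^ 2) t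
        + (v t + v (t - T)) ^ 2 + μ) ∧
      (v t + v (t - T)) ^ 2 ≤ A * (slidingIntegral T (fun s => slidingIntegral T v s ^ 2) t
        + slidingIntegral T v t ^ 2 + μ) ∧
      ∀ τ ∈ Set.Icc (t - T) t,
        v τ ^ 2 ≤ A * (slidingIntegral T (fun s => slidingIntegral T v s ^ 2) t
        + (v t + v (t - T)) ^ 2 + μ) := by
  have hω2 : 0 < ω ^ 2 := by positivity
  -- gap between `κ` and its critical value
  obtain ⟨g, hg, hgκ⟩ : ∃ g > 0, κ = (1 / 2 - g) * ω ^ 2 :=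
    ⟨1 / 2 - κ / ω ^ 2, by rw [gt_iff_lt, sub_pos, div_lt_iff₀ hω2]; linarith, by field_simp; ring⟩
  have hg2 : g < 1 / 2 := by
    by_contra hcon
    nlinarith
  set K := (2 * κ * T + 1) * T with hK
  have hK0 : 0 < K := by positivity
  set c := min (g * κ ^ 2) (κ * T / 4) with hc
  have hc0 : 0 < c := lt_min (by positivity) (by positivity)
  set B := κ ^ 2 / ω ^ 2 + K / ω ^ 2 with hB
  have hB0 : 0 < B := by positivity
  set A1 := κ ^ 2 + κ * T / 2 + K
  set A2 := κ ^ 2 + κ * (2 * T * B + T ^ 2) + κ * (2 * κ ^ 2 * T + 2 * T ^ 2)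
  set A3 := 8 / T ^ 2 * (1 + T * B)
  set A4 := 1 + 8 * (2 * κ ^ 2 * T + 2 * T ^ 2)
  have hA1 : 0 < A1 := by positivity
  have hA2 : 0 < A2 := by positivity
  have hA3 : 0 < A3 := by positivity
  have hA4 : 0 < A4 := by positivity
  refine ⟨c, hc0, A1 + A2 + A3 + A4, by positivity, ?_⟩
  intro v v' μ a t hμ hμ1 hta h
  subst hta
  obtain ⟨J, Y, hJ, hYJ, hη, hv2, hW⟩ := h.exists_antiperiodic_part hT hκ.le hμ1 hω hωT
  have hd := fun t ht => h.sq_sub_le hT hμ hμ1 (t := t) ht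
  have hI := slidingIntegral_sq_nonneg hT.le (slidingIntegral T v) (a + T)
  simp only [sumFunctional, diffFunctional, add_sub_cancel_right]
  set I := slidingIntegral T (fun s => slidingIntegral T v s ^ 2) (a + T)
  set η := slidingIntegral T v (a + T)
  rw [hv2]
  set s := v (a + T) + v a with hs
  have hdT := hd (a + T) ⟨by linarith, le_rfl⟩
  have hKμ : 0 ≤ K * μ := by positivity
  have hW' : ω ^ 2 * J ≤ κ ^ 2 * I + K * μ := by rw [hK]; linarith
  have hJB : J ≤ B * (I + μ) := by
    have : J ≤ (κ ^ 2 * I + K * μ) / ω ^ 2 := by rw [le_div_iff₀ hω2]; linarith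
    refine this.trans ?_
    have e : B * (I + μ) - (κ ^ 2 * I + K * μ) / ω ^ 2 = κ ^ 2 / ω ^ 2 * μ + K / ω ^ 2 * I := by
      rw [hB]; field_simp; ring
    have : 0 ≤ κ ^ 2 / ω ^ 2 * μ + K / ω ^ 2 * I := by positivity
    linarith
  have hF : κ ^ 2 / 2 * I - κ * (J + s * Y + T * s ^ 2 / 4) + κ * η * s
      = κ ^ 2 / 2 * I - κ * J + κ * T * s ^ 2 / 4 := by rw [hη]; ring
  rw [hF]
  have hs2 := sq_nonneg s
  have hη2 : η ^ 2 ≤ 2 * T * B * (I + μ) + T ^ 2 * s ^ 2 := by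
    have : η ^ 2 ≤ 2 * Y ^ 2 + T ^ 2 * s ^ 2 / 2 := by
      rw [hη]; linarith [sq_nonneg (Y - T * s / 2)]
    have h1 := mul_le_mul_of_nonneg_left hJB hT.le
    have h2 := mul_nonneg (sq_nonneg T) hs2
    linarith
  have hlift : ∀ {x y : ℝ}, 0 ≤ y → ∀ {A : ℝ}, x ≤ A * y → A ≤ A1 + A2 + A3 + A4 →
      x ≤ (A1 + A2 + A3 + A4) * y := fun hy _ hx hA =>
    hx.trans (mul_le_mul_of_nonneg_right hA hy)
  refine ⟨?_, ?_, ?_, ?_, ?_⟩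
  · have h1 : κ * J ≤ (1 / 2 - g) * (κ ^ 2 * I) + K * μ := by
      have : κ * J = (1 / 2 - g) * (ω ^ 2 * J) := by rw [← mul_assoc, ← hgκ]
      rw [this]
      have := mul_le_mul_of_nonneg_left hW' (by linarith : (0:ℝ) ≤ 1 / 2 - g)
      have := mul_nonneg (by linarith : (0:ℝ) ≤ 1 / 2 + g) hKμ
      linarith
    have h2 : c * I ≤ g * κ ^ 2 * I := mul_le_mul_of_nonneg_right (min_le_left _ _) hI
    have h3 : c * s ^ 2 ≤ κ * T / 4 * s ^ 2 := mul_le_mul_of_nonneg_right (min_le_right _ _) hs2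
    have h4 : K * μ ≤ (A1 + A2 + A3 + A4) * μ := mul_le_mul_of_nonneg_right
      (by have : K ≤ A1 := by simp only [A1]; linarith [sq_nonneg κ, mul_pos hκ hT]
          linarith) hμ
    linarith
  · refine hlift (by positivity) (A := A1) ?_ (by linarith)
    have : 0 ≤ κ * J := by positivity
    have : A1 * (I + s ^ 2) - (κ ^ 2 / 2 * I + κ * T * s ^ 2 / 4)
      = (κ ^ 2 / 2 + κ * T / 2 + K) * I + (κ ^ 2 + κ * T / 4 + K) * s ^ 2 := by
      simp only [A1]; ring
    have : 0 ≤ (κ ^ 2 / 2 + κ * T / 2 + K) * I + (κ ^ 2 + κ * T / 4 + K) * s ^ 2 := by positivity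
    linarith
  · refine hlift (by positivity) (A := A2) ?_ (by linarith)
    have h1 : |κ ^ 2 / 2 * I + κ * η * (v (a + T) - v a)|
        ≤ κ ^ 2 / 2 * I + κ * (η ^ 2 + (v (a + T) - v a) ^ 2) := by
      have := mul_nonneg hκ.le (sq_nonneg (η - (v (a + T) - v a)))
      have := mul_nonneg hκ.le (sq_nonneg (η + (v (a + T) - v a)))
      have := mul_nonneg (sq_nonneg κ) hI
      have := mul_nonneg hκ.le (sq_nonneg η)
      have := mul_nonneg hκ.le (sq_nonneg (v (a + T) - v a))
      exact abs_le.2 ⟨by linarith, by linarith⟩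
    refine h1.trans ?_
    have h2 := mul_le_mul_of_nonneg_left hη2 hκ.le
    have h3 := mul_le_mul_of_nonneg_left hdT hκ.le
    have e : A2 * (I + s ^ 2 + μ) - (κ ^ 2 / 2 * I + κ * (2 * T * B * (I + μ) + T ^ 2 * s ^ 2)
        + κ * (2 * κ ^ 2 * T * I + 2 * T ^ 2 * μ))
        = κ ^ 2 / 2 * I + κ ^ 2 * (s ^ 2 + μ) + κ * (2 * T * B) * s ^ 2 + κ * T ^ 2 * (I + μ)
          + κ * (2 * κ ^ 2 * T) * (s ^ 2 + μ) + κ * (2 * T ^ 2) * (I + s ^ 2) := by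
      simp only [A2]; ring
    have : 0 ≤ κ ^ 2 / 2 * I + κ ^ 2 * (s ^ 2 + μ) + κ * (2 * T * B) * s ^ 2 + κ * T ^ 2 * (I + μ)
          + κ * (2 * κ ^ 2 * T) * (s ^ 2 + μ) + κ * (2 * T ^ 2) * (I + s ^ 2) := by positivity
    linarith
  · refine hlift (by positivity) (A := A3) ?_ (by linarith)
    have h1 : T ^ 2 * s ^ 2 ≤ 8 * (η ^ 2 + T * J) := by
      have : T * s = 2 * (η - Y) := by rw [hη]; ring
      have : T ^ 2 * s ^ 2 = 4 * (η - Y) ^ 2 := by rw [← mul_pow, this]; ring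
      rw [this]; linarith [sq_nonneg (η + Y)]
    have h2 : s ^ 2 = (T ^ 2 * s ^ 2) / T ^ 2 := by field_simp
    rw [h2, div_le_iff₀ (by positivity)]
    have e : A3 * (I + η ^ 2 + μ) * T ^ 2 = 8 * (1 + T * B) * (I + η ^ 2 + μ) := by
      simp only [A3]; field_simp
    rw [e]
    have h3 := mul_le_mul_of_nonneg_left hJB hT.le
    have : 0 ≤ T * B * η ^ 2 := by positivity
    linarith
  · intro τ hτ
    refine hlift (by positivity) (A := A4) ?_ (by linarith)
    have hτ' := hd τ hτ
    have h1 : v τ = (v τ - v a) + s / 2 - (v (a + T) - v a) / 2 := by rw [hs]; ring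
    have h2 : v τ ^ 2 ≤ 4 * (v τ - v a) ^ 2 + s ^ 2 + (v (a + T) - v a) ^ 2 := by
      conv_lhs => rw [h1]
      linarith [sq_nonneg ((v τ - v a) - s / 2), sq_nonneg ((v τ - v a) + (v (a + T) - v a) / 2),
        sq_nonneg (s / 2 + (v (a + T) - v a) / 2), sq_nonneg (v τ - v a), sq_nonneg (s / 2),
        sq_nonneg ((v (a + T) - v a) / 2)]
    have e : A4 * (I + s ^ 2 + μ) - (5 * (2 * κ ^ 2 * T * I + 2 * T ^ 2 * μ) + s ^ 2)
      = I + μ + 6 * κ ^ 2 * T * I + 6 * T ^ 2 * μ + 16 * κ ^ 2 * T * (s ^ 2 + μ)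
        + 16 * T ^ 2 * (I + s ^ 2) := by simp only [A4]; ring
    have : 0 ≤ I + μ + 6 * κ ^ 2 * T * I + 6 * T ^ 2 * μ + 16 * κ ^ 2 * T * (s ^ 2 + μ)
        + 16 * T ^ 2 * (I + s ^ 2) := by positivity
    linarith

end IsApproxSolution

namespace IsApproxSolution

lemma hasDerivAt_delayed {κ T μ a b : ℝ} {v v' : ℝ → ℝ} (h : IsApproxSolution κ T μ v v' a b)
    {r : ℝ} (hr : r - T ∈ Set.Ioo a b) : HasDerivAt (fun r => v (r - T)) (v' (r - T)) r := by
  have := (h.hasDerivAt (r - T) hr).comp r ((hasDerivAt_id r).sub_const T)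
  simpa [Function.comp_def] using this

section window

variable {κ T μ t : ℝ} {v v' : ℝ → ℝ}

lemma sumFunctional_sub_le (h : IsApproxSolution κ T μ v v' (t - T) (t + T)) (hκ : 0 ≤ κ)
    (hT : 0 < T) :
    sumFunctional κ T v (t + T) - sumFunctional κ T v t
      ≤ -(κ ^ 2 / 2) * (∫ r in t..(t + T), (slidingIntegral T v r + slidingIntegral T v (r - T)) ^ 2)
        + 2 * κ * T ^ 2 * μ := by
  have hc := h.continuous_sliding
  have hv := h.continuous
  have hc2 := continuous_slidingIntegral T (f := fun s => slidingIntegral T v s ^ 2) (by fun_prop)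
  have hv2 := continuous_slidingIntegral T (f := fun s => v s ^ 2) (by fun_prop)
  have k := sub_le_integral_of_deriv_le (F := sumFunctional κ T v)
    (F' := fun r => κ ^ 2 / 2 * (slidingIntegral T v r ^ 2 - slidingIntegral T v (r - T) ^ 2)
      + κ * slidingIntegral T v r * (v' r + v' (r - T)))
    (g := fun r => -(κ ^ 2 / 2) * (slidingIntegral T v r + slidingIntegral T v (r - T)) ^ 2
      + 2 * κ * T * μ) (a := t) (b := t + T) (by linarith)
    (by unfold sumFunctional; fun_prop) (by fun_prop) ?_ ?_
  · rw [intervalIntegral.integral_add, intervalIntegral.integral_const_mul,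
      intervalIntegral.integral_const, smul_eq_mul] at k
    · linarith
    all_goals exact Continuous.intervalIntegrable (by fun_prop) _ _
  · intro r hr
    have h1 := hasDerivAt_slidingIntegral T (f := fun s => slidingIntegral T v s ^ 2)
      (by fun_prop) r
    have h2 := hasDerivAt_slidingIntegral T (f := fun s => v s ^ 2) (by fun_prop) r
    have h3 := hasDerivAt_slidingIntegral T hv r
    have h4 := h.hasDerivAt r ⟨by linarith [hr.1], hr.2⟩
    have h5 := h.hasDerivAt_delayed (r := r) ⟨by linarith [hr.1], by linarith [hr.2]⟩
    refine (((h1.const_mul (κ ^ 2 / 2)).sub (h2.const_mul κ)).add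
      ((h3.const_mul κ).mul (h4.add h5))).congr_deriv ?_
    simp only [Pi.add_apply]
    ring
  · intro r hr
    have h1 := abs_le.1 (h.defect_le r ⟨by linarith [hr.1], hr.2⟩)
    have h2 := abs_le.1 (h.defect_le (r - T) ⟨by linarith [hr.1], by linarith [hr.2]⟩)
    have h3 := h.abs_sliding_le hT.le (t := r) ⟨by linarith [hr.1], hr.2.le⟩
    set η := slidingIntegral T v r
    set ηT := slidingIntegral T v (r - T)
    set e := v' r + κ * η + (v' (r - T) + κ * ηT) with he
    have h4 : η * e ≤ T * (2 * μ) := by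
      refine (le_abs_self _).trans ?_
      rw [abs_mul]
      exact mul_le_mul h3 (abs_le.2 ⟨by linarith, by linarith⟩) (abs_nonneg _) hT.le
    have h5 : v' r + v' (r - T) = e - κ * (η + ηT) := by rw [he]; ring
    have h6 := mul_le_mul_of_nonneg_left h4 hκ
    simp only [h5]
    linarith

lemma diffFunctional_sub_le (h : IsApproxSolution κ T μ v v' (t - T) (t + T)) (hκ : 0 ≤ κ)
    (hT : 0 < T) :
    diffFunctional κ T v (t + T) - diffFunctional κ T v t
      ≤ -(κ ^ 2 / 2) * (∫ r in t..(t + T), (slidingIntegral T v r - slidingIntegral T v (r - T)) ^ 2)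
        + κ * (∫ r in t..(t + T), (v r - v (r - T)) ^ 2) + 2 * κ * T ^ 2 * μ := by
  have hc := h.continuous_sliding
  have hv := h.continuous
  have hc2 := continuous_slidingIntegral T (f := fun s => slidingIntegral T v s ^ 2) (by fun_prop)
  have k := sub_le_integral_of_deriv_le (F := diffFunctional κ T v)
    (F' := fun r => κ ^ 2 / 2 * (slidingIntegral T v r ^ 2 - slidingIntegral T v (r - T) ^ 2)
      + κ * (v r - v (r - T)) ^ 2
      + κ * slidingIntegral T v r * (v' r - v' (r - T)))
    (g := fun r => -(κ ^ 2 / 2) * (slidingIntegral T v r - slidingIntegral T v (r - T)) ^ 2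
      + κ * (v r - v (r - T)) ^ 2 + 2 * κ * T * μ) (a := t) (b := t + T) (by linarith)
    (by unfold diffFunctional; fun_prop) (by fun_prop) ?_ ?_
  · rw [intervalIntegral.integral_add, intervalIntegral.integral_add,
      intervalIntegral.integral_const_mul, intervalIntegral.integral_const_mul,
      intervalIntegral.integral_const, smul_eq_mul] at k
    · linarith
    all_goals exact Continuous.intervalIntegrable (by fun_prop) _ _
  · intro r hr
    have h1 := hasDerivAt_slidingIntegral T (f := fun s => slidingIntegral T v s ^ 2)
      (by fun_prop) r
    have h3 := hasDerivAt_slidingIntegral T hv r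
    have h4 := h.hasDerivAt r ⟨by linarith [hr.1], hr.2⟩
    have h5 := h.hasDerivAt_delayed (r := r) ⟨by linarith [hr.1], by linarith [hr.2]⟩
    refine ((h1.const_mul (κ ^ 2 / 2)).add
      ((h3.const_mul κ).mul (h4.sub h5))).congr_deriv ?_
    simp only [Pi.sub_apply]
    ring
  · intro r hr
    have h1 := abs_le.1 (h.defect_le r ⟨by linarith [hr.1], hr.2⟩)
    have h2 := abs_le.1 (h.defect_le (r - T) ⟨by linarith [hr.1], by linarith [hr.2]⟩)
    have h3 := h.abs_sliding_le hT.le (t := r) ⟨by linarith [hr.1], hr.2.le⟩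
    set η := slidingIntegral T v r
    set ηT := slidingIntegral T v (r - T)
    set e := v' r + κ * η - (v' (r - T) + κ * ηT) with he
    have h4 : η * e ≤ T * (2 * μ) := by
      refine (le_abs_self _).trans ?_
      rw [abs_mul]
      exact mul_le_mul h3 (abs_le.2 ⟨by linarith, by linarith⟩) (abs_nonneg _) hT.le
    have h5 : v' r - v' (r - T) = e - κ * (η - ηT) := by rw [he]; ring
    have h6 := mul_le_mul_of_nonneg_left h4 hκ
    simp only [h5]
    linarith

/-- Wirtinger's inequality for `v - v(· - T)`, whose boundary values on the window `[t, t + T]`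
sum up to `ρ`. -/
lemma exists_antiperiodic_part_sub (h : IsApproxSolution κ T μ v v' (t - T) (t + T)) (hκ : 0 ≤ κ)
    (hT : 0 < T) (hμ : 0 ≤ μ) (hμ1 : μ ≤ 1) {ω δ : ℝ} (hω : 0 < ω) (hωT : ω * T < Real.pi)
    (hδ : 0 < δ) :
    ∃ W ρ : ℝ, (∫ r in t..(t + T), (v r - v (r - T)) ^ 2)
        ≤ (1 + δ) * W + (1 + 1 / δ) * (T / 4) * ρ ^ 2 ∧
      ρ ^ 2 ≤ 2 * κ ^ 2 * T
        * (∫ r in t..(t + T), (slidingIntegral T v r + slidingIntegral T v (r - T)) ^ 2)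
        + 8 * T ^ 2 * μ ∧
      ω ^ 2 * W ≤ κ ^ 2
        * (∫ r in t..(t + T), (slidingIntegral T v r - slidingIntegral T v (r - T)) ^ 2)
        + (8 * κ * T + 4) * T * μ := by
  have hc := h.continuous_sliding
  have hv := h.continuous
  set ρ := v (t + T) - v (t - T) with hρ
  have htT : t ≤ t + T := by linarith
  refine ⟨∫ r in t..(t + T), (v r - v (r - T) - ρ / 2) ^ 2, ρ, ?_, ?_, ?_⟩
  · have e : (∫ r in t..(t + T), ((1 + δ) * (v r - v (r - T) - ρ / 2) ^ 2
        + (1 + 1 / δ) * (ρ ^ 2 / 4)))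
        = (1 + δ) * (∫ r in t..(t + T), (v r - v (r - T) - ρ / 2) ^ 2)
        + (1 + 1 / δ) * (T / 4) * ρ ^ 2 := by
      rw [intervalIntegral.integral_add, intervalIntegral.integral_const_mul,
        intervalIntegral.integral_const, smul_eq_mul]
      · ring
      all_goals exact Continuous.intervalIntegrable (by fun_prop) _ _
    rw [← e]
    refine intervalIntegral.integral_mono_on htT
      (Continuous.intervalIntegrable (by fun_prop) _ _)
      (Continuous.intervalIntegrable (by fun_prop) _ _) fun r _ => ?_
    set p := v r - v (r - T) - ρ / 2 with hp
    have : v r - v (r - T) = p + ρ / 2 := by rw [hp]; ring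
    rw [this]
    have : (1 + δ) * p ^ 2 + (1 + 1 / δ) * (ρ ^ 2 / 4) - (p + ρ / 2) ^ 2
        = (δ * p - ρ / 2) ^ 2 / δ := by field_simp; ring
    have : 0 ≤ (δ * p - ρ / 2) ^ 2 / δ := by positivity
    linarith
  · have h1 := h.abs_sub_add_integral_le (s := t - T) (t := t) le_rfl (by linarith) (by linarith)
    have h2 := h.abs_sub_add_integral_le (s := t) (t := t + T) (by linarith) (by linarith) le_rfl
    have h3 := sq_integral_le (g := fun r => slidingIntegral T v r + slidingIntegral T v (r - T))
      (by fun_prop) htT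
    rw [intervalIntegral.integral_add (Continuous.intervalIntegrable (by fun_prop) _ _)
      (Continuous.intervalIntegrable (by fun_prop) _ _),
      intervalIntegral.integral_comp_sub_right (fun r => slidingIntegral T v r)] at h3
    simp only [add_sub_cancel_right, add_sub_cancel_left, sub_sub_cancel] at h1 h2 h3
    rw [add_comm] at h3
    set A := ∫ r in (t - T)..t, slidingIntegral T v r
    set B := ∫ r in t..(t + T), slidingIntegral T v r
    have h4 : (ρ + κ * (A + B)) ^ 2 ≤ (2 * (μ * T)) ^ 2 := by
      have h1 := abs_le.1 h1
      have h2 := abs_le.1 h2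
      exact sq_le_sq' (by rw [hρ]; linarith) (by rw [hρ]; linarith)
    have h5 : 4 * ((μ - μ ^ 2) * T ^ 2) ≥ 0 := by
      have : 0 ≤ μ - μ ^ 2 := by nlinarith
      positivity
    have h6 := mul_le_mul_of_nonneg_left h3 (sq_nonneg κ)
    linarith [sq_nonneg (ρ + 2 * κ * (A + B))]
  · have k := wirtinger_antiperiodic (f := fun r => v r - v (r - T) - ρ / 2)
      (f' := fun r => v' r - v' (r - T))
      (g := fun r => κ ^ 2 * (slidingIntegral T v r - slidingIntegral T v (r - T)) ^ 2
        + (8 * κ * T + 4) * μ) hω hT hωT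
      (a := t) (by fun_prop) (by fun_prop) ?_ ?_ (by simp only [hρ, add_sub_cancel_right]; ring)
    · refine k.trans_eq ?_
      rw [intervalIntegral.integral_add, intervalIntegral.integral_const_mul,
        intervalIntegral.integral_const, smul_eq_mul]
      · ring
      all_goals exact Continuous.intervalIntegrable (by fun_prop) _ _
    · intro r hr
      exact ((h.hasDerivAt r ⟨by linarith [hr.1], hr.2⟩).sub
        (h.hasDerivAt_delayed (r := r) ⟨by linarith [hr.1], by linarith [hr.2]⟩)).sub_const _
    · intro r hr
      have h1 := abs_le.1 (h.defect_le r ⟨by linarith [hr.1], hr.2⟩)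
      have h2 := abs_le.1 (h.defect_le (r - T) ⟨by linarith [hr.1], by linarith [hr.2]⟩)
      have h3 := abs_le.1 (h.abs_sliding_le hT.le (t := r) ⟨by linarith [hr.1], hr.2.le⟩)
      have h4 := abs_le.1 (h.abs_sliding_le hT.le (t := r - T)
        ⟨by linarith [hr.1], by linarith [hr.2]⟩)
      set η := slidingIntegral T v r
      set ηT := slidingIntegral T v (r - T)
      set e := v' r + κ * η - (v' (r - T) + κ * ηT) with he
      have he2 : |e| ≤ 2 * μ := abs_le.2 ⟨by linarith, by linarith⟩
      have h5 : -((2 * T) * (2 * μ)) ≤ (η - ηT) * e := by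
        refine (abs_le.1 ?_).1
        rw [abs_mul]
        exact mul_le_mul (abs_le.2 ⟨by linarith, by linarith⟩) he2 (abs_nonneg _) (by positivity)
      have h6 : v' r - v' (r - T) = e - κ * (η - ηT) := by rw [he]; ring
      have h7 := mul_le_mul_of_nonneg_left h5 hκ
      have h8 : e ^ 2 ≤ 4 * μ := by
        have := sq_le_sq' (abs_le.1 he2).1 (abs_le.1 he2).2
        nlinarith
      simp only [h6]
      linarith

lemma integral_sq_add_add_sq_sub (h : IsApproxSolution κ T μ v v' (t - T) (t + T)) :
    (∫ r in t..(t + T), (slidingIntegral T v r + slidingIntegral T v (r - T)) ^ 2)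
      + (∫ r in t..(t + T), (slidingIntegral T v r - slidingIntegral T v (r - T)) ^ 2)
    = 2 * (slidingIntegral T (fun s => slidingIntegral T v s ^ 2) (t + T)
      + slidingIntegral T (fun s => slidingIntegral T v s ^ 2) t) := by
  have hc := h.continuous_sliding
  have e : slidingIntegral T (fun s => slidingIntegral T v s ^ 2) t
      = ∫ r in t..(t + T), slidingIntegral T v (r - T) ^ 2 := by
    rw [intervalIntegral.integral_comp_sub_right (fun r => slidingIntegral T v r ^ 2)]
    simp [slidingIntegral]
  have e2 : slidingIntegral T (fun s => slidingIntegral T v s ^ 2) (t + T)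
      = ∫ r in t..(t + T), slidingIntegral T v r ^ 2 := by
    rw [slidingIntegral, add_sub_cancel_right]
  rw [e, e2, ← intervalIntegral.integral_add, ← intervalIntegral.integral_add,
    ← intervalIntegral.integral_const_mul]
  · congr 1; ext r; ring
  all_goals exact Continuous.intervalIntegrable (by fun_prop) _ _

lemma sliding_sq_le (h : IsApproxSolution κ T μ v v' (t - T) (t + T)) (hT : 0 < T) :
    T * slidingIntegral T v (t + T) ^ 2
      ≤ (1 + T) * slidingIntegral T (fun s => slidingIntegral T v s ^ 2) (t + T)
        + T * ∫ r in t..(t + T), (v r - v (r - T)) ^ 2 := by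
  have hc := h.continuous_sliding
  have hv := h.continuous
  have k := sub_le_integral_of_deriv_le (F := fun r => (r - t) * slidingIntegral T v r ^ 2)
    (F' := fun r => slidingIntegral T v r ^ 2
      + (r - t) * (2 * slidingIntegral T v r * (v r - v (r - T))))
    (g := fun r => (1 + T) * slidingIntegral T v r ^ 2 + T * (v r - v (r - T)) ^ 2)
    (a := t) (b := t + T) (by linarith) (by fun_prop) (by fun_prop) ?_ ?_
  · rw [intervalIntegral.integral_add, intervalIntegral.integral_const_mul,
      intervalIntegral.integral_const_mul] at k
    · have e : slidingIntegral T (fun s => slidingIntegral T v s ^ 2) (t + T)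
          = ∫ r in t..(t + T), slidingIntegral T v r ^ 2 := by
        rw [slidingIntegral, add_sub_cancel_right]
      rw [e]
      simpa using k
    all_goals exact Continuous.intervalIntegrable (by fun_prop) _ _
  · intro r _
    refine (((hasDerivAt_id r).sub_const t).mul
      ((hasDerivAt_slidingIntegral T hv r).pow 2)).congr_deriv ?_
    simp
  · intro r hr
    set η := slidingIntegral T v r
    set d := v r - v (r - T)
    have h1 : 0 ≤ r - t := by linarith [hr.1]
    have h2 : 0 ≤ T - (r - t) := by linarith [hr.2]
    have := mul_nonneg h1 (sq_nonneg (η - d))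
    have := mul_nonneg h2 (add_nonneg (sq_nonneg η) (sq_nonneg d))
    linarith

end window

end IsApproxSolution

namespace IsApproxSolution

lemma dissipation {κ T ω : ℝ} (hκ : 0 < κ) (hT : 0 < T) (hω : 0 < ω)
    (hωT : ω * T < Real.pi) (hκω : 2 * κ < ω ^ 2) :
    ∃ c > 0, ∃ A > 0, ∀ (v v' : ℝ → ℝ) (μ t : ℝ), 0 ≤ μ → μ ≤ 1 →
      IsApproxSolution κ T μ v v' (t - T) (t + T) → ∃ P D : ℝ, 0 ≤ P ∧ 0 ≤ D ∧
      P + D = 2 * (slidingIntegral T (fun s => slidingIntegral T v s ^ 2) (t + T)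
        + slidingIntegral T (fun s => slidingIntegral T v s ^ 2) t) ∧
      sumFunctional κ T v (t + T) - sumFunctional κ T v t ≤ -c * P + A * μ ∧
      diffFunctional κ T v (t + T) - diffFunctional κ T v t ≤ -c * D + A * P + A * μ ∧
      slidingIntegral T v (t + T) ^ 2 ≤ A * (P + D + μ) := by
  have hω2 : 0 < ω ^ 2 := by positivity
  -- gap between `κ` and its critical value
  obtain ⟨g, hg, hgκ⟩ : ∃ g > 0, κ = (1 / 2 - g) * ω ^ 2 :=
    ⟨1 / 2 - κ / ω ^ 2, by rw [gt_iff_lt, sub_pos, div_lt_iff₀ hω2]; linarith, by field_simp; ring⟩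
  have hg2 : 0 < 1 / 2 - g := by
    by_contra hcon
    nlinarith
  obtain ⟨δ, hδ, hδg⟩ : ∃ δ > 0, (1 / 2 - g) * (1 + δ) = 1 / 2 - g / 2 :=
    ⟨g / (2 * (1 / 2 - g)), by positivity, by
      have : (1 / 2 - g) * (g / (2 * (1 / 2 - g))) = g / 2 := by
        rw [mul_div_assoc', mul_comm 2, mul_div_mul_left _ _ hg2.ne']
      rw [mul_add, this]; ring⟩
  set K := (8 * κ * T + 4) * T with hK
  have hK0 : 0 < K := by positivity
  set L := (1 + 1 / δ) * (T / 4) with hL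
  have hL0 : 0 < L := by positivity
  set B1 := L * (2 * κ ^ 2 * T)
  set B2 := K + κ * L * (8 * T ^ 2) + 2 * κ * T ^ 2
  set B3 := ((1 + T) + T * (κ ^ 2 + κ * B1 + B2) / κ) / T
  have hB1 : 0 < B1 := by positivity
  have hB2 : 0 < B2 := by positivity
  have hB3 : 0 < B3 := by positivity
  refine ⟨g / 2 * κ ^ 2, by positivity, κ * B1 + B2 + B3, by positivity, ?_⟩
  intro v v' μ t hμ hμ1 h
  have hsum := h.integral_sq_add_add_sq_sub
  have hF := h.sumFunctional_sub_le hκ.le hT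
  have hG := h.diffFunctional_sub_le hκ.le hT
  have hη := h.sliding_sq_le hT
  obtain ⟨W, ρ, hE, hρ, hW⟩ := h.exists_antiperiodic_part_sub hκ.le hT hμ hμ1 hω hωT hδ
  have hP0 : 0 ≤ ∫ r in t..(t + T), (slidingIntegral T v r + slidingIntegral T v (r - T)) ^ 2 :=
    intervalIntegral.integral_nonneg (by linarith) fun r _ => sq_nonneg _
  have hD0 : 0 ≤ ∫ r in t..(t + T), (slidingIntegral T v r - slidingIntegral T v (r - T)) ^ 2 :=
    intervalIntegral.integral_nonneg (by linarith) fun r _ => sq_nonneg _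
  have hI0 := slidingIntegral_sq_nonneg hT.le (slidingIntegral T v) t
  have hI1 := slidingIntegral_sq_nonneg hT.le (slidingIntegral T v) (t + T)
  set P := ∫ r in t..(t + T), (slidingIntegral T v r + slidingIntegral T v (r - T)) ^ 2
  set D := ∫ r in t..(t + T), (slidingIntegral T v r - slidingIntegral T v (r - T)) ^ 2
  set E := ∫ r in t..(t + T), (v r - v (r - T)) ^ 2
  rw [← hL] at hE
  rw [← hK] at hW
  have hκE : κ * E ≤ (1 / 2 - g / 2) * κ ^ 2 * D + κ * B1 * P + (B2 - 2 * κ * T ^ 2) * μ := by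
    have h1 := mul_le_mul_of_nonneg_left hE hκ.le
    have h2 : κ * ((1 + δ) * W) ≤ (1 / 2 - g / 2) * κ ^ 2 * D + K * μ := by
      have e : κ * ((1 + δ) * W) = (1 / 2 - g / 2) * (ω ^ 2 * W) := by
        rw [← hδg]; nth_rewrite 1 [hgκ]; ring
      have h3 := mul_le_mul_of_nonneg_left hW
        (by rw [← hδg]; positivity : 0 ≤ 1 / 2 - g / 2)
      have h4 : 0 ≤ (1 / 2 + g / 2) * (K * μ) := by positivity
      rw [e]
      linarith
    have h5 := mul_le_mul_of_nonneg_left hρ (by positivity : 0 ≤ κ * L)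
    have e : (B2 - 2 * κ * T ^ 2) * μ = K * μ + κ * L * (8 * T ^ 2 * μ) := by
      simp only [B2]; ring
    have e2 : κ * B1 * P = κ * L * (2 * κ ^ 2 * T * P) := by simp only [B1]; ring
    rw [e, e2]
    linarith
  refine ⟨P, D, hP0, hD0, hsum, ?_, ?_, ?_⟩
  · have h1 : 0 ≤ (κ * B1 + K + κ * L * (8 * T ^ 2) + B3) * μ := by positivity
    have h2 : 0 ≤ (1 / 2 - g) * κ ^ 2 * P := by positivity
    have h3 : 0 ≤ g * κ ^ 2 * P := by positivity
    simp only [B2]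
    linarith
  · have h1 : 0 ≤ (κ * B1 + B3) * μ := by positivity
    have h2 : 0 ≤ (B2 + B3) * P := by positivity
    linarith
  · have h1 : T * slidingIntegral T v (t + T) ^ 2 ≤ T * (B3 * (P + D + μ)) := by
      have e : T * (B3 * (P + D + μ)) = (1 + T) * (P + D + μ)
          + T * ((κ ^ 2 + κ * B1 + B2) * (P + D + μ) / κ) := by
        simp only [B3]; field_simp
      have h2 : E ≤ (κ ^ 2 + κ * B1 + B2) * (P + D + μ) / κ := by
        rw [le_div_iff₀ hκ]
        have h3 : 0 ≤ (1 / 2 + g / 2) * κ ^ 2 * D + (κ * B1 + B2) * D + (κ ^ 2 + B2) * P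
          + (κ ^ 2 + κ * B1 + 2 * κ * T ^ 2) * μ := by positivity
        linarith
      have h3 := mul_le_mul_of_nonneg_left h2 hT.le
      have h4 : 0 ≤ (1 + T) * (P + D + μ - slidingIntegral T (fun s => slidingIntegral T v s ^ 2)
          (t + T)) := mul_nonneg (by positivity) (by linarith)
      rw [e]
      linarith
    have h2 := le_of_mul_le_mul_left h1 hT
    have h3 : 0 ≤ (κ * B1 + B2) * (P + D + μ) := by positivity
    linarith

set_option maxHeartbeats 800000 in
lemma exists_lyapunov {κ T ω : ℝ} (hκ : 0 < κ) (hT : 0 < T) (hω : 0 < ω)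
    (hωT : ω * T < Real.pi) (hκω : 2 * κ < ω ^ 2) :
    ∃ V : (ℝ → ℝ) → ℝ → ℝ, ∃ A > 0, ∃ ρ > 0, ρ < 1 ∧ ∀ (v v' : ℝ → ℝ) (μ t : ℝ), 0 ≤ μ → μ ≤ 1 →
      (IsApproxSolution κ T μ v v' (t - T) t →
        (∀ q, (∀ τ ∈ Set.Icc (t - T - T) t, |v τ| ≤ q) → V v t ≤ A * (q ^ 2 + μ)) ∧
        ∀ τ ∈ Set.Icc (t - T) t, v τ ^ 2 ≤ A * (V v t + A * μ)) ∧
      (IsApproxSolution κ T μ v v' (t - T) (t + T) → V v (t + T) ≤ ρ * V v t + A * μ) := by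
  obtain ⟨c1, hc1, A1, hA1, H1⟩ := functional_bounds hκ hT hω hωT hκω
  obtain ⟨c2, hc2, A2, hA2, H2⟩ := dissipation hκ hT hω hωT hκω
  set α := (A1 + 1) / c1 + (A2 + c2) / c2 with hα
  have hα0 : 0 < α := by positivity
  have hα1 : A1 + 1 ≤ α * c1 := by
    rw [hα, add_mul, div_mul_cancel₀ _ hc1.ne']
    linarith [show 0 < (A2 + c2) / c2 * c1 by positivity]
  have hα2 : A2 + c2 ≤ α * c2 := by
    rw [hα, add_mul, div_mul_cancel₀ _ hc2.ne']
    linarith [show 0 < (A1 + 1) / c1 * c2 by positivity]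
  set A3 := (α + 1) * A1 with hA3
  have hA30 : 0 < A3 := by positivity
  set A4 := A3 * (1 + A1) * (1 + A2) with hA4
  have hA40 : 0 < A4 := by positivity
  set A5 := (α + 1) * A2 + c2 with hA5
  have hA50 : 0 < A5 := by positivity
  set θ := c2 / A4 with hθ
  have hθ0 : 0 < θ := by positivity
  have hA4θ : A4 * θ = c2 := by rw [hθ]; field_simp
  set A := A1 + A3 + 1 + A5 + A3 * (T ^ 3 + 5) with hA
  refine ⟨fun v t => α * sumFunctional κ T v t + diffFunctional κ T v t, A, by positivity,
    1 / (1 + θ), by positivity, (div_lt_one (by positivity)).2 (by linarith), ?_⟩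
  -- comparison of the combined functional with `I + s²`
  have key : ∀ (v v' : ℝ → ℝ) (μ a t : ℝ), 0 ≤ μ → μ ≤ 1 → t = a + T →
      IsApproxSolution κ T μ v v' a t →
      slidingIntegral T (fun s => slidingIntegral T v s ^ 2) t + (v t + v (t - T)) ^ 2 - A3 * μ
        ≤ α * sumFunctional κ T v t + diffFunctional κ T v t ∧
      α * sumFunctional κ T v t + diffFunctional κ T v t ≤ A3 *
        (slidingIntegral T (fun s => slidingIntegral T v s ^ 2) t + (v t + v (t - T)) ^ 2 + μ) := by
    intro v v' μ a t hμ hμ1 ht h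
    obtain ⟨h1, h2, h3, -, -⟩ := H1 v v' μ a t hμ hμ1 ht h
    have hI := slidingIntegral_sq_nonneg hT.le (slidingIntegral T v) t
    set I := slidingIntegral T (fun s => slidingIntegral T v s ^ 2) t
    set s := v t + v (t - T)
    have hs : 0 ≤ s ^ 2 := sq_nonneg s
    have h3' := abs_le.1 h3
    have m1 := mul_le_mul_of_nonneg_left h1 hα0.le
    have m2 := mul_le_mul_of_nonneg_left h2 hα0.le
    have m3 := mul_le_mul_of_nonneg_right hα1 (add_nonneg hI hs)
    have m4 : 0 ≤ α * (A1 * μ) := by positivity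
    constructor
    · rw [hA3]; linarith
    · rw [hA3]; linarith
  intro v v' μ t hμ hμ1
  constructor
  · intro h
    obtain ⟨k1, k2⟩ := key v v' μ (t - T) t hμ hμ1 (by ring) h
    obtain ⟨-, -, -, -, h5⟩ := H1 v v' μ (t - T) t hμ hμ1 (by ring) h
    have hI := slidingIntegral_sq_nonneg hT.le (slidingIntegral T v) t
    set I := slidingIntegral T (fun s => slidingIntegral T v s ^ 2) t with hIdef
    set s := v t + v (t - T) with hsdef
    have hs : 0 ≤ s ^ 2 := sq_nonneg s
    refine ⟨fun q hq => ?_, fun τ hτ => (h5 τ hτ).trans ?_⟩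
    · have hq0 : 0 ≤ q := (abs_nonneg _).trans (hq t ⟨by linarith, le_rfl⟩)
      have hI2 : I ≤ T ^ 3 * q ^ 2 := by
        have := intervalIntegral.norm_integral_le_of_norm_le_const (a := t - T) (b := t)
          (f := fun s => slidingIntegral T v s ^ 2) (C := (q * T) ^ 2) (fun s hs => by
          rw [Set.uIoc_of_le (by linarith)] at hs
          rw [Real.norm_eq_abs, abs_of_nonneg (sq_nonneg _), ← sq_abs]
          refine pow_le_pow_left₀ (abs_nonneg _) ?_ 2
          have := intervalIntegral.norm_integral_le_of_norm_le_const (a := s - T) (b := s) (f := v)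
            (C := q) (fun r hr => by
              rw [Set.uIoc_of_le (by linarith)] at hr
              exact hq r ⟨by linarith [hs.1, hr.1], by linarith [hs.2, hr.2]⟩)
          rwa [sub_sub_cancel, abs_of_pos hT] at this)
        have h2 := (le_abs_self _).trans this
        rw [sub_sub_cancel, abs_of_pos hT] at h2
        exact h2.trans (by linarith)
      have hs2 : s ^ 2 ≤ 4 * q ^ 2 := by
        have h1 := abs_le.1 (hq t ⟨by linarith, le_rfl⟩)
        have h2 := abs_le.1 (hq (t - T) ⟨by linarith, by linarith⟩)
        nlinarith
      have hq2 : 0 ≤ q ^ 2 := sq_nonneg q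
      have hT3 : 0 ≤ T ^ 3 := by positivity
      have hT3μ : 0 ≤ T ^ 3 * μ := mul_nonneg hT3 hμ
      have m := mul_le_mul_of_nonneg_left
        (by linarith : I + s ^ 2 + μ ≤ (T ^ 3 + 5) * (q ^ 2 + μ)) hA30.le
      have m2 : 0 ≤ (A1 + A3 + 1 + A5) * (q ^ 2 + μ) := by positivity
      rw [hA]; linarith
    · have hAA : A3 + 1 ≤ A := by
        rw [hA]; have : 0 < A3 * (T ^ 3 + 5) := by positivity
        linarith
      have hA1A : A1 ≤ A := by
        rw [hA]; have : 0 < A3 * (T ^ 3 + 5) := by positivity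
        linarith
      have m := mul_le_mul_of_nonneg_right hAA hμ
      exact mul_le_mul hA1A (by linarith) (by positivity) (by linarith)
  · intro h
    obtain ⟨k1, -⟩ := key v v' μ (t - T) t hμ hμ1 (by ring) (h.mono le_rfl (by linarith))
    obtain ⟨-, k2⟩ := key v v' μ t (t + T) hμ hμ1 rfl (h.mono (by linarith) le_rfl)
    obtain ⟨-, -, -, h4, -⟩ := H1 v v' μ t (t + T) hμ hμ1 rfl (h.mono (by linarith) le_rfl)
    obtain ⟨P, D, hP, hD, hPD, hF, hG, hη⟩ := H2 v v' μ t hμ hμ1 h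
    have hI0 := slidingIntegral_sq_nonneg hT.le (slidingIntegral T v) t
    have hI1 := slidingIntegral_sq_nonneg hT.le (slidingIntegral T v) (t + T)
    set I0 := slidingIntegral T (fun s => slidingIntegral T v s ^ 2) t
    set I1 := slidingIntegral T (fun s => slidingIntegral T v s ^ 2) (t + T)
    set s1 := v (t + T) + v (t + T - T)
    set S := P + D + μ with hS
    have hS0 : 0 ≤ S := by positivity
    show α * sumFunctional κ T v (t + T) + diffFunctional κ T v (t + T)
      ≤ 1 / (1 + θ) * (α * sumFunctional κ T v t + diffFunctional κ T v t) + A * μ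
    set V1 := α * sumFunctional κ T v (t + T) + diffFunctional κ T v (t + T) with hV1
    set V0 := α * sumFunctional κ T v t + diffFunctional κ T v t with hV0
    have hV1S : V1 ≤ A4 * S := by
      have e1 : I1 + s1 ^ 2 + μ ≤ (1 + A1) * (1 + A2) * S := by
        have m1 : I1 + slidingIntegral T v (t + T) ^ 2 + μ ≤ (1 + A2) * S := by linarith
        have m2 := mul_le_mul_of_nonneg_left m1 hA1.le
        have m3 : 0 ≤ A2 * S := by positivity
        linarith
      have := mul_le_mul_of_nonneg_left e1 hA30.le
      rw [hA4]; linarith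
    have hΔ : V1 ≤ V0 - c2 * S + A5 * μ := by
      have m1 := mul_le_mul_of_nonneg_left hF hα0.le
      have m2 := mul_le_mul_of_nonneg_right hα2 hP
      rw [hA5, hS, hV1, hV0]
      linarith
    have hfin : V1 * (1 + θ) ≤ V0 + A5 * μ := by
      have := mul_le_mul_of_nonneg_right hV1S hθ0.le
      rw [show A4 * S * θ = c2 * S by rw [← hA4θ]; ring] at this
      linarith
    have hA5A : A5 ≤ A := by
      rw [hA]; have : 0 < A3 * (T ^ 3 + 5) := by positivity
      linarith
    have h1 : V1 ≤ 1 / (1 + θ) * (V0 + A5 * μ) := by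
      rw [one_div_mul_eq_div, le_div_iff₀ (by positivity)]; exact hfin
    have h2 : 1 / (1 + θ) * (A5 * μ) ≤ A * μ := by
      have : 1 / (1 + θ) ≤ 1 := (div_le_one (by positivity)).2 (by linarith)
      exact (mul_le_of_le_one_left (by positivity) this).trans
        (mul_le_mul_of_nonneg_right hA5A hμ)
    linarith

end IsApproxSolution

namespace IsApproxSolution

/-- Approximate solutions decay exponentially, up to their defect. -/
theorem sq_le_pow {κ T ω : ℝ} (hκ : 0 < κ) (hT : 0 < T) (hω : 0 < ω)
    (hωT : ω * T < Real.pi) (hκω : 2 * κ < ω ^ 2) :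
    ∃ A > 0, ∃ ρ > 0, ρ < 1 ∧ ∀ (v v' : ℝ → ℝ) (μ a q : ℝ) (k : ℕ), 0 ≤ μ → μ ≤ 1 →
      IsApproxSolution κ T μ v v' a (a + (k + 1) * T) →
      (∀ τ ∈ Set.Icc (a - T) (a + T), |v τ| ≤ q) →
      ∀ τ ∈ Set.Icc (a + k * T) (a + (k + 1) * T), v τ ^ 2 ≤ A * (ρ ^ k * q ^ 2 + μ) := by
  obtain ⟨V, A, hA, ρ, hρ, hρ1, H⟩ := exists_lyapunov hκ hT hω hωT hκω
  have hρ2 : 0 < 1 - ρ := by linarith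
  refine ⟨A * (A + A + A / (1 - ρ) + A), by positivity, ρ, hρ, hρ1, ?_⟩
  intro v v' μ a q k hμ hμ1 h hq τ hτ
  have hV : ∀ j : ℕ, j ≤ k →
      V v (a + (j + 1) * T) ≤ ρ ^ j * (A * (q ^ 2 + μ)) + A / (1 - ρ) * μ := by
    intro j
    induction j with
    | zero =>
      intro _
      have hkT : 0 ≤ (k : ℝ) * T := by positivity
      have := ((H v v' μ (a + T) hμ hμ1).1 (h.mono (by linarith) (by linarith))).1 q
        (fun τ hτ => hq τ ⟨by linarith [hτ.1], hτ.2⟩)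
      have h2 : 0 ≤ A / (1 - ρ) * μ := by positivity
      simp only [Nat.cast_zero, zero_add, one_mul, pow_zero]
      linarith
    | succ j ih =>
      intro hj
      have hjk : ((j : ℝ) + 1) * T ≤ k * T := by
        gcongr; exact_mod_cast hj
      have hj0 : 0 ≤ (j : ℝ) * T := by positivity
      have h1 := (H v v' μ (a + (j + 1) * T) hμ hμ1).2 (h.mono (by linarith) (by linarith))
      have h2 := mul_le_mul_of_nonneg_left (ih (by omega)) hρ.le
      have e : A / (1 - ρ) = ρ * (A / (1 - ρ)) + A := by field_simp; ring
      rw [show a + ((j : ℝ) + 1) * T + T = a + (((j + 1 : ℕ) : ℝ) + 1) * T by push_cast; ring] at h1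
      rw [e, pow_succ]
      linarith
  have hkT : 0 ≤ (k : ℝ) * T := by positivity
  have h1 := ((H v v' μ (a + (k + 1) * T) hμ hμ1).1 (h.mono (by linarith) le_rfl)).2 τ
    ⟨by linarith [hτ.1], hτ.2⟩
  refine h1.trans ?_
  rw [mul_assoc]
  refine mul_le_mul_of_nonneg_left ?_ hA.le
  have h2 := hV k le_rfl
  have h3 : 0 ≤ (A + A / (1 - ρ) + A) * (ρ ^ k * q ^ 2) := by positivity
  have h4 : ρ ^ k * (A * μ) ≤ A * μ := mul_le_of_le_one_left (by positivity)
    (pow_le_one₀ hρ.le hρ1.le)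
  have h5 : 0 ≤ A * μ := by positivity
  linarith

end IsApproxSolution

lemma le_of_delay_gronwall {K T φ m L : ℝ} (hK : 0 < K) (hT : 0 ≤ T) (hφ : 0 ≤ φ) {E E' : ℝ → ℝ}
    (hE : Continuous E) (hE0 : ∀ t ∈ Set.Icc (-T) L, 0 ≤ E t) (hm : ∀ t ∈ Set.Icc (-T) 0, E t ≤ m)
    (hderiv : ∀ t ∈ Set.Ioo 0 L, HasDerivAt E (E' t) t)
    (hle : ∀ t ∈ Set.Ioo 0 L, E' t ≤ K * (E t + E (t - T)) + φ) {t : ℝ} (ht : t ∈ Set.Icc 0 L) :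
    E t ≤ Real.exp (2 * K * t) * ((1 + K * T) * m + φ / (2 * K)) := by
  have hs : ∀ s ∈ Set.Icc 0 L, 0 ≤ slidingIntegral T E s := fun s hs =>
    intervalIntegral.integral_nonneg (by linarith) fun r hr =>
      hE0 r ⟨by linarith [hr.1, hs.1], by linarith [hr.2, hs.2]⟩
  have hsc := continuous_slidingIntegral T hE
  have hexp : ∀ s : ℝ, HasDerivAt (fun s => Real.exp (-(2 * K * s)))
      (-(2 * K) * Real.exp (-(2 * K * s))) s := fun s => by
    have := ((hasDerivAt_id s).const_mul (2 * K)).neg.exp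
    simpa [mul_comm] using this
  have k := sub_le_integral_of_deriv_le
    (F := fun s => Real.exp (-(2 * K * s)) * (E s + K * slidingIntegral T E s + φ / (2 * K)))
    (F' := fun s => -(2 * K) * Real.exp (-(2 * K * s))
        * (E s + K * slidingIntegral T E s + φ / (2 * K))
      + Real.exp (-(2 * K * s)) * (E' s + K * (E s - E (s - T))))
    (g := fun _ => 0) ht.1 (by fun_prop) (by fun_prop) ?_ ?_
  · have h0 : slidingIntegral T E 0 ≤ T * m := by
      have := intervalIntegral.integral_mono_on (μ := MeasureTheory.volume) (a := 0 - T) (b := 0) (f := E) (g := fun _ => m)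
        (by linarith) (hE.intervalIntegrable _ _) intervalIntegrable_const
        (fun r hr => hm r ⟨by linarith [hr.1], hr.2⟩)
      simpa [slidingIntegral] using this
    have h1 := hm 0 ⟨by linarith, le_rfl⟩
    have h2 := mul_le_mul_of_nonneg_left (hs t ht) hK.le
    simp only [mul_zero, neg_zero, Real.exp_zero, one_mul, intervalIntegral.integral_zero] at k
    have h3 : Real.exp (-(2 * K * t)) * (E t + K * slidingIntegral T E t + φ / (2 * K))
        ≤ (1 + K * T) * m + φ / (2 * K) := by
      have := mul_le_mul_of_nonneg_left h0 hK.le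
      linarith
    have h4 := mul_le_mul_of_nonneg_left h3 (Real.exp_pos (2 * K * t)).le
    rw [← mul_assoc, ← Real.exp_add, add_neg_cancel, Real.exp_zero, one_mul] at h4
    have h5 : 0 ≤ φ / (2 * K) := by positivity
    linarith
  · intro s hs'
    have hsL : s ∈ Set.Ioo 0 L := ⟨hs'.1, hs'.2.trans_le ht.2⟩
    exact (hexp s).mul (((hderiv s hsL).add
      ((hasDerivAt_slidingIntegral T hE s).const_mul K)).add_const _)
  · intro s hs'
    have hsL : s ∈ Set.Ioo 0 L := ⟨hs'.1, hs'.2.trans_le ht.2⟩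
    have h1 := hle s hsL
    have h2 := mul_nonneg (mul_nonneg hK.le hK.le) (hs s (Set.Ioo_subset_Icc_self hsL))
    have e : 2 * K * (φ / (2 * K)) = φ := by field_simp
    have h3 : E' s + K * (E s - E (s - T))
        - 2 * K * (E s + K * slidingIntegral T E s + φ / (2 * K)) ≤ 0 := by
      rw [mul_add, e]; linarith
    have := mul_nonpos_of_nonneg_of_nonpos (Real.exp_pos (-(2 * K * s))).le h3
    linarith

/-- Delay equations on `(0, L)`, up to errors controlled by `σ` and `φ`, satisfied by the phase `ψ`
and the rescaled energy `b` of a perturbation of a large periodic orbit. -/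
structure IsSlowSystem (T σ φ L : ℝ) (ψ ψ' b b' c v' : ℝ → ℝ) : Prop where
  continuous_phase : Continuous ψ
  continuous_energy : Continuous b
  continuous_coeff : Continuous c
  abs_coeff_le : ∀ t, |c t| ≤ σ
  phase_hasDerivAt : ∀ t ∈ Set.Ioo 0 L, HasDerivAt ψ (ψ' t) t
  energy_hasDerivAt : ∀ t ∈ Set.Ioo 0 L, HasDerivAt b (b' t) t
  phase_le : ∀ t ∈ Set.Ioo 0 L,
    |ψ' t - b t| ≤ σ * (|ψ t - ψ (t - T)| + |b t| + |b (t - T)|) + φ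
  energy_le : ∀ t ∈ Set.Ioo 0 L,
    |b' t| ≤ |ψ t - ψ (t - T)| + σ * (|b t| + |b (t - T)|) + φ
  corrected_hasDerivAt : ∀ t ∈ Set.Ioo T L,
    HasDerivAt (fun s => b s + c s * (ψ s - ψ (s - T))) (v' t) t
  corrected_le : ∀ t ∈ Set.Ioo T L,
    |v' t + 1 / 3 * (ψ t - ψ (t - T))| ≤ σ * (|ψ t - ψ (t - T)| + |ψ (t - T) - ψ (t - T - T)|
      + |b t| + |b (t - T)| + |b (t - T - T)|) + φ

namespace IsSlowSystem

variable {T σ φ L : ℝ} {ψ ψ' b b' c v' : ℝ → ℝ}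

lemma translate (h : IsSlowSystem T σ φ L ψ ψ' b b' c v') {τ : ℝ} (hτ : 0 ≤ τ)
    (p : ℝ) :
    IsSlowSystem T σ φ (L - τ) (fun t => ψ (t + τ) - p) (fun t => ψ' (t + τ)) (fun t => b (t + τ))
      (fun t => b' (t + τ)) (fun t => c (t + τ)) (fun t => v' (t + τ)) where
  continuous_phase := by have := h.continuous_phase; fun_prop
  continuous_energy := by have := h.continuous_energy; fun_prop
  continuous_coeff := by have := h.continuous_coeff; fun_prop
  abs_coeff_le t := h.abs_coeff_le _
  phase_hasDerivAt t ht :=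
    ((h.phase_hasDerivAt (t + τ) ⟨by linarith [ht.1], by linarith [ht.2]⟩).comp_add_const t τ).sub_const p
  energy_hasDerivAt t ht :=
    (h.energy_hasDerivAt (t + τ) ⟨by linarith [ht.1], by linarith [ht.2]⟩).comp_add_const t τ
  phase_le t ht := by
    have := h.phase_le (t + τ) ⟨by linarith [ht.1], by linarith [ht.2]⟩
    simpa only [sub_sub_sub_cancel_right, add_sub_right_comm] using this
  energy_le t ht := by
    have := h.energy_le (t + τ) ⟨by linarith [ht.1], by linarith [ht.2]⟩
    simpa only [sub_sub_sub_cancel_right, add_sub_right_comm] using this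
  corrected_hasDerivAt t ht := by
    have := (h.corrected_hasDerivAt (t + τ)
      ⟨by linarith [ht.1], by linarith [ht.2]⟩).comp_add_const t τ
    simpa only [sub_sub_sub_cancel_right, add_sub_right_comm] using this
  corrected_le t ht := by
    have := h.corrected_le (t + τ) ⟨by linarith [ht.1], by linarith [ht.2]⟩
    simpa only [sub_sub_sub_cancel_right, add_sub_right_comm] using this

/-- Gronwall bound for the slow system. -/
lemma growth (h : IsSlowSystem T σ φ L ψ ψ' b b' c v') (hT : 0 ≤ T) (hσ : σ ≤ 1)
    {m : ℝ} (hψ0 : ∀ t ∈ Set.Icc (-T) 0, |ψ t| ≤ m) (hb0 : ∀ t ∈ Set.Icc (-T) 0, |b t| ≤ m)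
    {t : ℝ} (ht : t ∈ Set.Icc 0 L) :
    b t ^ 2 + ψ t ^ 2 ≤ Real.exp (16 * t) * (2 + 16 * T) * (m ^ 2 + φ ^ 2) := by
  have hc1 := h.continuous_phase
  have hc2 := h.continuous_energy
  have k := le_of_delay_gronwall (K := 8) (T := T) (φ := 2 * φ ^ 2) (m := 2 * m ^ 2) (L := L)
    (E := fun t => b t ^ 2 + ψ t ^ 2) (E' := fun t => 2 * b t * b' t + 2 * ψ t * ψ' t)
    (by norm_num) hT (by positivity) (by fun_prop) (fun _ _ => by positivity) ?_ ?_ ?_ ht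
  · refine k.trans ?_
    rw [show (2 : ℝ) * 8 = 16 by norm_num, mul_assoc]
    refine mul_le_mul_of_nonneg_left ?_ (Real.exp_pos _).le
    have : 0 ≤ T * φ ^ 2 := by positivity
    have : 0 ≤ φ ^ 2 := by positivity
    linarith
  · intro s hs
    have h1 := sq_le_sq' (abs_le.1 (hψ0 s hs)).1 (abs_le.1 (hψ0 s hs)).2
    have h2 := sq_le_sq' (abs_le.1 (hb0 s hs)).1 (abs_le.1 (hb0 s hs)).2
    linarith
  · intro s hs
    exact (((h.energy_hasDerivAt s hs).fun_pow 2).fun_add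
      ((h.phase_hasDerivAt s hs).fun_pow 2)).congr_deriv (by simp)
  · intro s hs
    have h1 := h.phase_le s hs
    have h2 := h.energy_le s hs
    have hη := abs_sub (ψ s) (ψ (s - T))
    have hσ1 : σ * (|ψ s - ψ (s - T)| + |b s| + |b (s - T)|)
        ≤ |ψ s - ψ (s - T)| + |b s| + |b (s - T)| := mul_le_of_le_one_left (by positivity) hσ
    have hσ2 : σ * (|b s| + |b (s - T)|) ≤ |b s| + |b (s - T)| :=
      mul_le_of_le_one_left (by positivity) hσ
    have h3 : |ψ' s| ≤ |ψ s| + |ψ (s - T)| + 2 * |b s| + |b (s - T)| + φ := by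
      have := abs_sub_abs_le_abs_sub (ψ' s) (b s)
      linarith
    have h4 : |b' s| ≤ |ψ s| + |ψ (s - T)| + |b s| + |b (s - T)| + φ := by linarith
    have h5 : b s * b' s ≤ |b s| * (|ψ s| + |ψ (s - T)| + |b s| + |b (s - T)| + φ) := by
      refine (le_abs_self _).trans ?_
      rw [abs_mul]; gcongr
    have h6 : ψ s * ψ' s ≤ |ψ s| * (|ψ s| + |ψ (s - T)| + 2 * |b s| + |b (s - T)| + φ) := by
      refine (le_abs_self _).trans ?_
      rw [abs_mul]; gcongr
    rw [← sq_abs (b s), ← sq_abs (ψ s), ← sq_abs (b (s - T)), ← sq_abs (ψ (s - T))]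
    linarith [sq_nonneg (|b s| - |ψ s|), sq_nonneg (|b s| - |ψ (s - T)|),
      sq_nonneg (|b s| - |b (s - T)|), sq_nonneg (|ψ s| - |ψ (s - T)|),
      sq_nonneg (|ψ s| - |b (s - T)|), sq_nonneg (|b s| - φ), sq_nonneg (|ψ s| - φ),
      sq_nonneg (|b s|), sq_nonneg (|ψ s|), sq_nonneg (|b (s - T)|), sq_nonneg (|ψ (s - T)|),
      sq_nonneg φ]

end IsSlowSystem

namespace IsSlowSystem

variable {T σ φ L : ℝ} {ψ ψ' b b' c v' : ℝ → ℝ}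

lemma abs_le_of_growth (h : IsSlowSystem T σ φ L ψ ψ' b b' c v') (hT : 0 ≤ T) (hσ : σ ≤ 1)
    (hφ : 0 ≤ φ) {m R C : ℝ} (hm : 0 ≤ m) (hR : R ≤ L) (hC : 1 ≤ C)
    (hRC : Real.exp (16 * R) * (4 + 32 * T) ≤ C ^ 2) (hφm : φ ≤ m)
    (hψ0 : ∀ t ∈ Set.Icc (-T) 0, |ψ t| ≤ m) (hb0 : ∀ t ∈ Set.Icc (-T) 0, |b t| ≤ m)
    {t : ℝ} (ht : t ∈ Set.Icc (-T) R) : |ψ t| ≤ C * m ∧ |b t| ≤ C * m := by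
  have hmC : m ≤ C * m := le_mul_of_one_le_left hm hC
  rcases le_total t 0 with h0 | h0
  · exact ⟨(hψ0 t ⟨ht.1, h0⟩).trans hmC, (hb0 t ⟨ht.1, h0⟩).trans hmC⟩
  · have k := h.growth hT hσ hψ0 hb0 ⟨h0, ht.2.trans hR⟩
    have h1 : Real.exp (16 * t) * (2 + 16 * T) * (m ^ 2 + φ ^ 2) ≤ (C * m) ^ 2 := by
      have h2 : Real.exp (16 * t) ≤ Real.exp (16 * R) := Real.exp_le_exp.2 (by linarith [ht.2])
      have h3 : φ ^ 2 ≤ m ^ 2 := pow_le_pow_left₀ hφ hφm 2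
      calc Real.exp (16 * t) * (2 + 16 * T) * (m ^ 2 + φ ^ 2)
          ≤ Real.exp (16 * R) * (2 + 16 * T) * (m ^ 2 + m ^ 2) := by gcongr
        _ = Real.exp (16 * R) * (4 + 32 * T) * m ^ 2 := by ring
        _ ≤ C ^ 2 * m ^ 2 := by gcongr
        _ = (C * m) ^ 2 := by ring
    have hCm : 0 ≤ C * m := by positivity
    exact ⟨abs_le_of_sq_le_sq (by linarith [sq_nonneg (b t)]) hCm,
      abs_le_of_sq_le_sq (by linarith [sq_nonneg (ψ t)]) hCm⟩

/-- Bounds for the corrected energy `v = b + c (ψ - ψ(· - T))` in terms of a common bound. -/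
lemma corrected_bounds (h : IsSlowSystem T σ φ L ψ ψ' b b' c v') (hT : 0 < T) (hσ0 : 0 ≤ σ)
    {M : ℝ} (hφ : φ ≤ σ * M) (hM : ∀ t ∈ Set.Icc (-T) L, |ψ t| ≤ M ∧ |b t| ≤ M) :
    (∀ t ∈ Set.Icc 0 L, |b t + c t * (ψ t - ψ (t - T)) - b t| ≤ 2 * σ * M) ∧
    (∀ t ∈ Set.Icc T L, |ψ t - ψ (t - T)
      - slidingIntegral T (fun s => b s + c s * (ψ s - ψ (s - T))) t| ≤ 7 * T * σ * M) ∧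
    (∀ t ∈ Set.Ioo 0 L, |ψ' t - b t| ≤ 5 * σ * M) ∧
    (∀ t ∈ Set.Ioo T L,
      |v' t + 1 / 3 * slidingIntegral T (fun s => b s + c s * (ψ s - ψ (s - T))) t|
        ≤ (8 + 3 * T) * σ * M) := by
  have hc1 := h.continuous_phase
  have hc2 := h.continuous_energy
  have hc3 := h.continuous_coeff
  have hη : ∀ t ∈ Set.Icc 0 L, |ψ t - ψ (t - T)| ≤ 2 * M := fun t ht => by
    have h1 := (hM t ⟨by linarith [ht.1], ht.2⟩).1
    have h2 := (hM (t - T) ⟨by linarith [ht.1], by linarith [ht.2]⟩).1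
    linarith [abs_sub (ψ t) (ψ (t - T))]
  have hv : ∀ t ∈ Set.Icc 0 L, |b t + c t * (ψ t - ψ (t - T)) - b t| ≤ 2 * σ * M := fun t ht => by
    rw [add_sub_cancel_left, abs_mul]
    calc |c t| * |ψ t - ψ (t - T)| ≤ σ * (2 * M) :=
          mul_le_mul (h.abs_coeff_le t) (hη t ht) (abs_nonneg _) hσ0
      _ = 2 * σ * M := by ring
  have hψ' : ∀ t ∈ Set.Ioo 0 L, |ψ' t - b t| ≤ 5 * σ * M := fun t ht => by
    have h1 := h.phase_le t ht
    have h2 := hη t (Set.Ioo_subset_Icc_self ht)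
    have h3 := (hM t ⟨by linarith [ht.1], ht.2.le⟩).2
    have h4 := (hM (t - T) ⟨by linarith [ht.1], by linarith [ht.2]⟩).2
    have h5 := mul_le_mul_of_nonneg_left
      (by linarith : |ψ t - ψ (t - T)| + |b t| + |b (t - T)| ≤ 4 * M) hσ0
    linarith
  have hs : ∀ t ∈ Set.Icc T L, |ψ t - ψ (t - T)
      - slidingIntegral T (fun s => b s + c s * (ψ s - ψ (s - T))) t| ≤ 7 * T * σ * M := by
    intro t ht
    have hmem : ∀ r ∈ Set.Ioo (t - T) t, r ∈ Set.Ioo 0 L := fun r hr =>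
      ⟨by linarith [hr.1, ht.1], by linarith [hr.2, ht.2]⟩
    have hval : ∀ r ∈ Set.Ioo (t - T) t,
        |ψ' r - (b r + c r * (ψ r - ψ (r - T)))| ≤ 7 * σ * M := fun r hr => by
      have h1 := abs_le.1 (hψ' r (hmem r hr))
      have h2 := abs_le.1 (hv r (Set.Ioo_subset_Icc_self (hmem r hr)))
      rw [abs_le]; constructor <;> linarith
    have hcv : Continuous fun s => b s + c s * (ψ s - ψ (s - T)) := by fun_prop
    have hcn : Continuous fun s => -(b s + c s * (ψ s - ψ (s - T))) := by fun_prop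
    have k1 := sub_le_integral_of_deriv_le (F := ψ) (F' := ψ') (a := t - T) (b := t)
      (g := fun r => (b r + c r * (ψ r - ψ (r - T))) + 7 * σ * M) (by linarith)
      hc1.continuousOn (by fun_prop) (fun r hr => h.phase_hasDerivAt r (hmem r hr))
      (fun r hr => by linarith [(abs_le.1 (hval r hr)).2])
    have k2 := sub_le_integral_of_deriv_le (F := fun r => -ψ r) (F' := fun r => -ψ' r)
      (a := t - T) (b := t)
      (g := fun r => -(b r + c r * (ψ r - ψ (r - T))) + 7 * σ * M) (by linarith)
      (by fun_prop) (by fun_prop) (fun r hr => (h.phase_hasDerivAt r (hmem r hr)).neg)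
      (fun r hr => by linarith [(abs_le.1 (hval r hr)).1])
    rw [intervalIntegral.integral_add (hcv.intervalIntegrable _ _) (by simp)] at k1
    rw [intervalIntegral.integral_add (hcn.intervalIntegrable _ _) (by simp),
      intervalIntegral.integral_neg] at k2
    simp only [intervalIntegral.integral_const, sub_sub_cancel, smul_eq_mul] at k1 k2
    rw [slidingIntegral, abs_le]
    constructor <;> linarith
  refine ⟨hv, hs, hψ', fun t ht => ?_⟩
  have h1 := abs_le.1 (h.corrected_le t ht)
  have h2 := abs_le.1 (hs t (Set.Ioo_subset_Icc_self ht))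
  have h3 := hη t ⟨by linarith [ht.1], ht.2.le⟩
  have h4 := hη (t - T) ⟨by linarith [ht.1], by linarith [ht.2]⟩
  have h5 := (hM t ⟨by linarith [ht.1], ht.2.le⟩).2
  have h6 := (hM (t - T) ⟨by linarith [ht.1], by linarith [ht.2]⟩).2
  have h7 := (hM (t - T - T) ⟨by linarith [ht.1], by linarith [ht.2]⟩).2
  have h8 := mul_le_mul_of_nonneg_left (by linarith : |ψ t - ψ (t - T)|
      + |ψ (t - T) - ψ (t - T - T)| + |b t| + |b (t - T)| + |b (t - T - T)| ≤ 7 * M) hσ0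
  have hM0 : 0 ≤ M := (abs_nonneg _).trans h5
  have h9 : 0 ≤ T * σ * M := by positivity
  rw [abs_le]
  constructor <;> linarith

/-- After finitely many delays, a solution of the slow system is close to a constant phase. -/
theorem contraction (hT : 0 < T) (hT2 : T ^ 2 < 3 / 2 * Real.pi ^ 2) :
    ∃ J : ℕ, 1 ≤ J ∧ ∃ σ > 0, σ ≤ 1 ∧ ∃ C > 0, ∀ (φ m : ℝ) (ψ ψ' b b' c v' : ℝ → ℝ),
      0 ≤ φ → 0 < m →
      IsSlowSystem T σ φ ((J + 1) * T) ψ ψ' b b' c v' →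
      (∀ t ∈ Set.Icc (-T) T, |ψ t| ≤ m ∧ |b t| ≤ m) →
      ∃ p, ∀ t ∈ Set.Icc (J * T - T) (J * T + T),
        |ψ t - p| ≤ m / 2 + C * φ ∧ |b t| ≤ m / 2 + C * φ := by
  obtain ⟨ω, hω0, hωT, hω2⟩ : ∃ ω > 0, ω * T < Real.pi ∧ 2 * (1 / 3 : ℝ) < ω ^ 2 := by
    have h1 : Real.sqrt (2 / 3) < Real.pi / T := by
      rw [Real.sqrt_lt' (by positivity), div_pow, lt_div_iff₀ (by positivity)]
      linarith
    obtain ⟨ω, hω1, hω2⟩ := exists_between h1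
    have h0 : 0 ≤ Real.sqrt (2 / 3) := Real.sqrt_nonneg _
    refine ⟨ω, h0.trans_lt hω1, (lt_div_iff₀ hT).1 hω2, ?_⟩
    have := (Real.sqrt_lt' (h0.trans_lt hω1)).1 hω1
    linarith
  obtain ⟨A, hA, ρ, hρ, hρ1, H⟩ :=
    IsApproxSolution.sq_le_pow (κ := 1 / 3) (by norm_num) hT hω0 hωT hω2
  set ε := 1 / (4 * (1 + T)) with hε
  have hε0 : 0 < ε := by positivity
  have hgrowth : ∀ R : ℝ, 0 ≤ R → ∃ C : ℝ, 1 ≤ C ∧ Real.exp (16 * R) * (4 + 32 * T) ≤ C ^ 2 := by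
    intro R hR
    have h1 : 1 ≤ Real.exp (16 * R) * (4 + 32 * T) := by
      have := Real.one_le_exp (show 0 ≤ 16 * R by positivity)
      nlinarith
    exact ⟨_, h1, by nlinarith⟩
  obtain ⟨C0, hC01, hC0⟩ := hgrowth (2 * T) (by positivity)
  obtain ⟨J, hJ⟩ := exists_pow_lt_of_lt_one
    (show 0 < ε ^ 2 / (2 * (A * (3 * C0) ^ 2)) by positivity) hρ1
  obtain ⟨C, hC1, hC⟩ := hgrowth ((J + 4) * T) (by positivity)
  have hCpos : 0 < C := by linarith
  obtain ⟨σ, hσ0, hσ⟩ : ∃ σ > 0, σ ≤ 1 ∧ 7 * σ * C ≤ ε ∧ (8 + 3 * T) * σ ≤ 3 ∧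
      A * ((8 + 3 * T) * σ * (3 * C ^ 2)) ≤ ε ^ 2 / 2 := by
    refine ⟨min (min 1 (ε / (7 * C))) (min (3 / (8 + 3 * T))
      (ε ^ 2 / 2 / (A * ((8 + 3 * T) * (3 * C ^ 2))))), by positivity, ?_, ?_, ?_, ?_⟩
    · exact (min_le_left _ _).trans (min_le_left _ _)
    · have := (min_le_left (min 1 (ε / (7 * C))) (min (3 / (8 + 3 * T))
        (ε ^ 2 / 2 / (A * ((8 + 3 * T) * (3 * C ^ 2)))))).trans (min_le_right _ _)
      rw [le_div_iff₀ (by positivity)] at this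
      linarith
    · have := (min_le_right (min 1 (ε / (7 * C))) (min (3 / (8 + 3 * T))
        (ε ^ 2 / 2 / (A * ((8 + 3 * T) * (3 * C ^ 2)))))).trans (min_le_left _ _)
      rw [le_div_iff₀ (by positivity)] at this
      linarith
    · have := (min_le_right (min 1 (ε / (7 * C))) (min (3 / (8 + 3 * T))
        (ε ^ 2 / 2 / (A * ((8 + 3 * T) * (3 * C ^ 2)))))).trans (min_le_right _ _)
      rw [le_div_iff₀ (by positivity)] at this
      linarith
  obtain ⟨hσ1, hσC, hσT, hσA⟩ := hσ
  refine ⟨J + 3, by omega, σ, hσ0, hσ1, C / σ, by positivity, ?_⟩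
  intro φ m ψ ψ' b b' c v' hφ hm h h0
  have hL : (((J + 3 : ℕ) : ℝ) + 1) * T = (J + 4) * T := by push_cast; ring
  rw [hL] at h
  have hJT : 0 ≤ (J : ℝ) * T := by positivity
  have hwin : ∀ t ∈ Set.Icc (((J + 3 : ℕ) : ℝ) * T - T) (((J + 3 : ℕ) : ℝ) * T + T),
      t ∈ Set.Icc ((J + 2) * T) ((J + 4) * T) := fun t ht => by
    obtain ⟨h1, h2⟩ := ht
    push_cast at h1 h2
    exact ⟨by linarith, by linarith⟩
  have hψ0 : ∀ t ∈ Set.Icc (-T) 0, |ψ t| ≤ m := fun t ht =>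
    (h0 t ⟨ht.1, ht.2.trans hT.le⟩).1
  have hb0 : ∀ t ∈ Set.Icc (-T) 0, |b t| ≤ m := fun t ht =>
    (h0 t ⟨ht.1, ht.2.trans hT.le⟩).2
  rcases le_total (σ * m) φ with hcase | hcase
  · -- large forcing: the growth bound suffices
    refine ⟨0, fun t ht => ?_⟩
    have ht' := hwin t ht
    have hmφ : m ≤ φ / σ := by rw [le_div_iff₀ hσ0]; linarith
    have hφσ : φ ≤ φ / σ := by
      rw [le_div_iff₀ hσ0]; exact mul_le_of_le_one_right hφ hσ1
    have k := h.abs_le_of_growth hT.le hσ1 hφ (m := φ / σ) (R := (J + 4) * T) (C := C)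
      (by positivity) le_rfl hC1 hC hφσ (fun t ht => (hψ0 t ht).trans hmφ)
      (fun t ht => (hb0 t ht).trans hmφ) (t := t) ⟨by linarith [ht'.1], ht'.2⟩
    have e : C * (φ / σ) = C / σ * φ := by ring
    rw [e] at k
    rw [sub_zero]
    exact ⟨by linarith [k.1], by linarith [k.2]⟩
  have hφm : φ ≤ m := hcase.trans (mul_le_of_le_one_left hm.le hσ1)
  have hbd0 := fun t (ht : t ∈ Set.Icc (-T) (2 * T)) =>
    h.abs_le_of_growth hT.le hσ1 hφ hm.le (by linarith) hC01 hC0 hφm hψ0 hb0 (t := t) ht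
  have hbd := fun t (ht : t ∈ Set.Icc (-T) ((J + 4) * T)) =>
    h.abs_le_of_growth hT.le hσ1 hφ hm.le le_rfl hC1 hC hφm hψ0 hb0 (t := t) ht
  have hmC : m ≤ C * m := le_mul_of_one_le_left hm.le hC1
  obtain ⟨hv, hs, hψ', hv'⟩ := h.corrected_bounds hT hσ0.le (M := C * m)
    (hcase.trans (by gcongr)) hbd
  have hc1 := h.continuous_phase
  have hc2 := h.continuous_energy
  have hc3 := h.continuous_coeff
  set v := fun s => b s + c s * (ψ s - ψ (s - T)) with hvdef
  have hvc : Continuous v := by rw [hvdef]; fun_prop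
  set Q := 3 * (C * m) with hQ
  have hQ0 : 0 < Q := by positivity
  -- pointwise bound for `v`
  have hvM : ∀ (t M : ℝ), t ∈ Set.Icc 0 ((J + 4) * T) → |ψ t| ≤ M → |b t| ≤ M →
      |ψ (t - T)| ≤ M → |v t| ≤ 3 * M := by
    intro t M ht h1 h2 h3
    have h4 : |c t * (ψ t - ψ (t - T))| ≤ 1 * (M + M) := by
      rw [abs_mul]
      exact mul_le_mul ((h.abs_coeff_le t).trans hσ1)
        ((abs_sub _ _).trans (add_le_add h1 h3)) (abs_nonneg _) zero_le_one
    have := abs_add_le (b t) (c t * (ψ t - ψ (t - T)))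
    simp only [hvdef]; linarith
  have happrox : IsApproxSolution (1 / 3) T ((8 + 3 * T) * σ / 3) (fun s => v s / Q)
      (fun s => v' s / Q) T ((J + 4) * T) := by
    refine ⟨by fun_prop, fun t ht => ?_, fun t ht => ?_, fun t ht => ?_⟩
    · rw [abs_div, abs_of_pos hQ0, div_le_one hQ0]
      rw [sub_self] at ht
      have h1 := hbd t ⟨by linarith [ht.1], ht.2⟩
      exact hvM t _ ht h1.1 h1.2 (hbd (t - T) ⟨by linarith [ht.1], by linarith [ht.2]⟩).1
    · exact (h.corrected_hasDerivAt t ht).div_const Q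
    · have e : v' t / Q + 1 / 3 * slidingIntegral T (fun s => v s / Q) t
          = (v' t + 1 / 3 * slidingIntegral T v t) / Q := by
        simp only [slidingIntegral, intervalIntegral.integral_div]; ring
      rw [e, abs_div, abs_of_pos hQ0, div_le_iff₀ hQ0]
      refine (hv' t ht).trans (le_of_eq ?_)
      rw [hQ]; ring
  have hsmall : ∀ t ∈ Set.Icc ((J + 1) * T) ((J + 4) * T), |v t| ≤ ε * m := by
    intro t ht
    obtain ⟨k, hk, hkJ, ht'⟩ : ∃ k : ℕ, J ≤ k ∧ k ≤ J + 2 ∧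
        t ∈ Set.Icc (T + k * T) (T + (k + 1) * T) := by
      rcases le_total t ((J + 2) * T) with h1 | h1
      · exact ⟨J, le_rfl, by omega, by linarith [ht.1], by linarith⟩
      rcases le_total t ((J + 3) * T) with h2 | h2
      · exact ⟨J + 1, by omega, by omega, by push_cast; linarith, by push_cast; linarith⟩
      · exact ⟨J + 2, by omega, le_rfl, by push_cast; linarith, by push_cast; linarith [ht.2]⟩
    have hkJ' : ((k : ℝ) + 1) * T ≤ (J + 3) * T := by
      refine mul_le_mul_of_nonneg_right ?_ hT.le
      have : (k : ℝ) ≤ ((J + 2 : ℕ) : ℝ) := by exact_mod_cast hkJ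
      push_cast at this; linarith
    have key := H _ _ ((8 + 3 * T) * σ / 3) T (3 * (C0 * m) / Q) k (by positivity) (by linarith)
      (happrox.mono le_rfl (by linarith)) (fun τ hτ => by
        rw [abs_div, abs_of_pos hQ0]
        rw [sub_self] at hτ
        gcongr
        have h1 := hbd0 τ ⟨by linarith [hτ.1], by linarith [hτ.2]⟩
        exact hvM τ _ ⟨hτ.1, by linarith [hτ.2]⟩ h1.1 h1.2
          (hbd0 (τ - T) ⟨by linarith [hτ.1], by linarith [hτ.2]⟩).1) t ht'
    simp only [div_pow] at key
    rw [div_le_iff₀ (by positivity)] at key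
    have e : A * (ρ ^ k * ((3 * (C0 * m)) ^ 2 / Q ^ 2) + (8 + 3 * T) * σ / 3) * Q ^ 2
        = (ρ ^ k * (A * (3 * C0) ^ 2) + A * ((8 + 3 * T) * σ * (3 * C ^ 2))) * m ^ 2 := by
      field_simp
      rw [hQ]; ring
    rw [e] at key
    have h1 : ρ ^ k * (A * (3 * C0) ^ 2) ≤ ε ^ 2 / 2 := by
      have e1 : ρ ^ k ≤ ε ^ 2 / (2 * (A * (3 * C0) ^ 2)) :=
        (pow_le_pow_of_le_one hρ.le hρ1.le hk).trans hJ.le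
      calc ρ ^ k * (A * (3 * C0) ^ 2)
          ≤ ε ^ 2 / (2 * (A * (3 * C0) ^ 2)) * (A * (3 * C0) ^ 2) := by gcongr
        _ = ε ^ 2 / 2 := by field_simp
    refine abs_le_of_sq_le_sq (key.trans ?_) (by positivity)
    rw [mul_pow ε m]
    exact mul_le_mul_of_nonneg_right (by linarith) (sq_nonneg m)
  have hσm : 7 * σ * (C * m) ≤ ε * m := by
    calc 7 * σ * (C * m) = 7 * σ * C * m := by ring
      _ ≤ ε * m := by gcongr
  have hσm0 : 0 ≤ σ * (C * m) := by positivity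
  have hbsmall : ∀ t ∈ Set.Icc ((J + 2) * T) ((J + 4) * T), |b t| ≤ ε * m + 2 * σ * (C * m) := by
    intro t ht
    have h1 := hsmall t ⟨by linarith [ht.1], ht.2⟩
    have h2 := hv t ⟨by linarith [ht.1], ht.2⟩
    rw [abs_sub_comm] at h2
    have := abs_sub_abs_le_abs_sub (b t) (v t)
    simp only [hvdef] at this h1
    linarith
  have hεT : 2 * (ε * m) * (1 + T) = m / 2 := by rw [hε]; field_simp; ring
  have hεm : 0 ≤ ε * m := by positivity
  have hεmT : 0 ≤ ε * m * T := by positivity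
  have hCφ : 0 ≤ C / σ * φ := by positivity
  refine ⟨ψ ((J + 3) * T), fun t ht => ⟨?_, ?_⟩⟩
  · have ht' := hwin t ht
    have hder : ∀ r ∈ Set.Ioo ((J + 2) * T : ℝ) ((J + 4) * T), |ψ' r| ≤ 2 * (ε * m) := by
      intro r hr
      have h1 := hbsmall r (Set.Ioo_subset_Icc_self hr)
      have h2 := hψ' r ⟨by linarith [hr.1], hr.2⟩
      have := abs_sub_abs_le_abs_sub (ψ' r) (b r)
      linarith
    have hmv : ∀ r s : ℝ, (J + 2) * T ≤ r → r ≤ s → s ≤ (J + 4) * T →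
        |ψ s - ψ r| ≤ 2 * (ε * m) * (s - r) := by
      intro r s hr hrs hs
      have hmem : ∀ x ∈ Set.Ioo r s, x ∈ Set.Ioo ((J + 2) * T : ℝ) ((J + 4) * T) := fun x hx =>
        ⟨by linarith [hx.1], by linarith [hx.2]⟩
      have k1 := sub_le_integral_of_deriv_le (F := ψ) (F' := ψ') (g := fun _ => 2 * (ε * m)) hrs
        hc1.continuousOn continuousOn_const
        (fun x hx => h.phase_hasDerivAt x ⟨by linarith [(hmem x hx).1], (hmem x hx).2⟩)
        (fun x hx => (abs_le.1 (hder x (hmem x hx))).2)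
      have k2 := sub_le_integral_of_deriv_le (F := fun x => -ψ x) (F' := fun x => -ψ' x)
        (g := fun _ => 2 * (ε * m)) hrs (by fun_prop) continuousOn_const
        (fun x hx => (h.phase_hasDerivAt x ⟨by linarith [(hmem x hx).1], (hmem x hx).2⟩).neg)
        (fun x hx => by linarith [(abs_le.1 (hder x (hmem x hx))).1])
      simp only [intervalIntegral.integral_const, smul_eq_mul] at k1 k2
      rw [abs_le]
      constructor <;> linarith
    rcases le_total t ((J + 3) * T) with h1 | h1
    · have k := hmv t _ ht'.1 h1 (by linarith)
      rw [abs_sub_comm] at k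
      have := mul_le_mul_of_nonneg_left (by linarith [ht'.1] : (J + 3) * T - t ≤ T)
        (by positivity : 0 ≤ 2 * (ε * m))
      linarith
    · have k := hmv _ t (by linarith) h1 ht'.2
      have := mul_le_mul_of_nonneg_left (by linarith [ht'.2] : t - (J + 3) * T ≤ T)
        (by positivity : 0 ≤ 2 * (ε * m))
      linarith
  · have := hbsmall t (hwin t ht)
    linarith

end IsSlowSystem

namespace IsSlowSystem

variable {T σ φ L : ℝ} {ψ ψ' b b' c v' : ℝ → ℝ}

lemma mono (h : IsSlowSystem T σ φ L ψ ψ' b b' c v') {L' : ℝ} (hL : L' ≤ L) :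
    IsSlowSystem T σ φ L' ψ ψ' b b' c v' where
  continuous_phase := h.continuous_phase
  continuous_energy := h.continuous_energy
  continuous_coeff := h.continuous_coeff
  abs_coeff_le := h.abs_coeff_le
  phase_hasDerivAt t ht := h.phase_hasDerivAt t ⟨ht.1, ht.2.trans_le hL⟩
  energy_hasDerivAt t ht := h.energy_hasDerivAt t ⟨ht.1, ht.2.trans_le hL⟩
  phase_le t ht := h.phase_le t ⟨ht.1, ht.2.trans_le hL⟩
  energy_le t ht := h.energy_le t ⟨ht.1, ht.2.trans_le hL⟩
  corrected_hasDerivAt t ht := h.corrected_hasDerivAt t ⟨ht.1, ht.2.trans_le hL⟩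
  corrected_le t ht := h.corrected_le t ⟨ht.1, ht.2.trans_le hL⟩

theorem iterated_contraction (hT : 0 < T) (hT2 : T ^ 2 < 3 / 2 * Real.pi ^ 2) :
    ∃ J : ℕ, 1 ≤ J ∧ ∃ σ > 0, σ ≤ 1 ∧ ∃ C > 0, ∀ (j : ℕ) (φ m : ℝ) (ψ ψ' b b' c v' : ℝ → ℝ),
      0 ≤ φ → 0 < m →
      IsSlowSystem T σ φ ((j * J + 1) * T) ψ ψ' b b' c v' →
      (∀ t ∈ Set.Icc (-T) T, |ψ t| ≤ m ∧ |b t| ≤ m) →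
      ∃ p, ∀ t ∈ Set.Icc (j * J * T - T) (j * J * T + T),
        |ψ t - p| ≤ m / 2 ^ j + C * φ ∧ |b t| ≤ m / 2 ^ j + C * φ := by
  obtain ⟨J, hJ, σ, hσ0, hσ1, C, hC, H⟩ := contraction hT hT2
  refine ⟨J, hJ, σ, hσ0, hσ1, 2 * C, by positivity, ?_⟩
  intro j φ m ψ ψ' b b' c v' hφ hm
  induction j with
  | zero =>
    intro _ h0
    refine ⟨0, fun t ht => ?_⟩
    simp only [Nat.cast_zero, zero_mul, zero_sub, zero_add] at ht
    have hCφ : 0 ≤ 2 * C * φ := by positivity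
    have h1 := h0 t ht
    simp only [sub_zero, pow_zero, div_one]
    exact ⟨by linarith, by linarith⟩
  | succ j ih =>
    intro h h0
    have hjJ : 0 ≤ (j : ℝ) * J * T := by positivity
    have hJT : 0 ≤ (J : ℝ) * T := by positivity
    obtain ⟨p, hp⟩ := ih (h.mono (by push_cast; linarith)) h0
    have e : (((j + 1 : ℕ) : ℝ) * J + 1) * T - j * J * T = (J + 1) * T := by push_cast; ring
    have h1 := h.translate hjJ p
    rw [e] at h1
    obtain ⟨p', hp'⟩ := H φ (m / 2 ^ j + 2 * C * φ) _ _ _ _ _ _ hφ (by positivity) h1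
      (fun t ht => hp _ ⟨by linarith [ht.1], by linarith [ht.2]⟩)
    refine ⟨p + p', fun t ht => ?_⟩
    push_cast at ht
    have h2 := hp' (t - j * J * T) ⟨by linarith [ht.1], by linarith [ht.2]⟩
    simp only [sub_add_cancel, sub_sub] at h2
    have e2 : m / 2 ^ (j + 1) + 2 * C * φ = (m / 2 ^ j + 2 * C * φ) / 2 + C * φ := by
      rw [pow_succ]; field_simp; ring
    rwa [e2]

end IsSlowSystem

/-- A `T`-antiperiodic solution `x`, with derivative `x'`, of the double-well Duffing equation,
with energy `h / 4`. -/
structure IsDuffingOrbit (T h : ℝ) (x x' : ℝ → ℝ) : Prop where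
  hasDerivAt : ∀ t, HasDerivAt x (x' t) t
  hasDerivAt' : ∀ t, HasDerivAt x' (x t - x t ^ 3) t
  energy : ∀ t, 2 * x' t ^ 2 - 2 * x t ^ 2 + x t ^ 4 = h
  antiperiodic : ∀ t, x (t - T) = -x t
  antiperiodic' : ∀ t, x' (t - T) = -x' t

/-- A solution `y`, with derivative `y'`, of the delayed Duffing equation on `(0, ∞)`. -/
structure IsDelayedDuffing (T : ℝ) (y y' : ℝ → ℝ) : Prop where
  continuous : Continuous y
  continuous' : Continuous y'
  hasDerivAt : ∀ t > 0, HasDerivAt y (y' t) t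
  hasDerivAt' : ∀ t > 0, HasDerivAt y' (-y (t - T) - y t ^ 3) t

lemma IsDelayedDuffing.translate {T : ℝ} {y y' : ℝ → ℝ} (hy : IsDelayedDuffing T y y') {τ : ℝ}
    (hτ : 0 ≤ τ) : IsDelayedDuffing T (fun t => y (t + τ)) (fun t => y' (t + τ)) where
  continuous := by have := hy.continuous; fun_prop
  continuous' := by have := hy.continuous'; fun_prop
  hasDerivAt t ht := (hy.hasDerivAt (t + τ) (by linarith)).comp_add_const t τ
  hasDerivAt' t ht := by
    have := (hy.hasDerivAt' (t + τ) (by linarith)).comp_add_const t τ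
    simpa only [add_sub_right_comm] using this

namespace IsDuffingOrbit

variable {T h : ℝ} {x x' : ℝ → ℝ}

lemma translate (hx : IsDuffingOrbit T h x x') (τ : ℝ) :
    IsDuffingOrbit T h (fun t => x (t + τ)) (fun t => x' (t + τ)) where
  hasDerivAt t := (hx.hasDerivAt (t + τ)).comp_add_const t τ
  hasDerivAt' t := (hx.hasDerivAt' (t + τ)).comp_add_const t τ
  energy t := hx.energy _
  antiperiodic t := by rw [← hx.antiperiodic, add_sub_right_comm]
  antiperiodic' t := by rw [← hx.antiperiodic', add_sub_right_comm]

lemma continuous (hx : IsDuffingOrbit T h x x') : Continuous x :=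
  continuous_iff_continuousAt.2 fun t => (hx.hasDerivAt t).continuousAt

lemma continuous' (hx : IsDuffingOrbit T h x x') : Continuous x' :=
  continuous_iff_continuousAt.2 fun t => (hx.hasDerivAt' t).continuousAt

lemma sq_le (hx : IsDuffingOrbit T h x x') (t : ℝ) : x t ^ 2 ≤ 1 + Real.sqrt (h + 1) := by
  have h1 : x t ^ 2 - 1 ≤ Real.sqrt (h + 1) := by
    apply Real.le_sqrt_of_sq_le
    nlinarith [hx.energy t, sq_nonneg (x' t)]
  linarith

lemma deriv_sq_le (hx : IsDuffingOrbit T h x x') (t : ℝ) : x' t ^ 2 ≤ (h + 1) / 2 := by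
  nlinarith [hx.energy t, sq_nonneg (x t ^ 2 - 1)]

/-- Smallness of an orbit of large energy relative to its energy. -/
lemma small (hx : IsDuffingOrbit T h x x') {s : ℝ} (hs : 0 < s) (hs1 : s ≤ 1)
    (hh : 16 / s ^ 4 ≤ h + 1) : 1 ≤ h ∧ ∀ t, x t ^ 2 ≤ s * h ∧ |x t * x' t| ≤ s * h := by
  set r := Real.sqrt (h + 1) with hr
  have hs4 : 0 < s ^ 4 := by positivity
  have hh0 : 0 < h + 1 := lt_of_lt_of_le (by positivity) hh
  have hr2 : r ^ 2 = h + 1 := Real.sq_sqrt hh0.le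
  have hrs : 4 / s ^ 2 ≤ r := by
    apply Real.le_sqrt_of_sq_le
    rw [div_pow, ← pow_mul]; norm_num; linarith
  have hs2 : s ^ 2 ≤ 1 := pow_le_one₀ hs.le hs1
  have hr4' : 4 ≤ s ^ 2 * r := by
    rw [div_le_iff₀ (by positivity)] at hrs; linarith
  have hr4 : 4 ≤ r := by nlinarith
  have hhr : r ^ 2 / 2 ≤ h := by nlinarith
  refine ⟨by nlinarith, fun t => ?_⟩
  have h1 := hx.sq_le t
  have h2 := hx.deriv_sq_le t
  have hsr : 4 ≤ s * r := by nlinarith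
  have h3 : 2 * r ≤ s * h := by
    have := mul_le_mul_of_nonneg_left hhr hs.le
    nlinarith
  refine ⟨by linarith, abs_le_of_sq_le_sq ?_ (by linarith)⟩
  calc (x t * x' t) ^ 2 = x t ^ 2 * x' t ^ 2 := by ring
    _ ≤ (2 * r) * (r ^ 2 / 2) := by
      refine mul_le_mul (by linarith) (by linarith) (by positivity) (by positivity)
    _ = 1 * r ^ 3 := by ring
    _ ≤ (s ^ 2 * r / 4) * r ^ 3 := by
      refine mul_le_mul_of_nonneg_right (by linarith) (by positivity)
    _ = s ^ 2 * (r ^ 2 / 2) ^ 2 := by ring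
    _ ≤ s ^ 2 * h ^ 2 := by gcongr
    _ = (s * h) ^ 2 := by ring

end IsDuffingOrbit

/-- Phase coordinate of `(y, y')` relative to the orbit point `(x, x')`. -/
noncomputable def phaseCoord (h : ℝ) (x x' y y' : ℝ → ℝ) (t : ℝ) : ℝ :=
  (2 * x' t * (y t - x t) - x t * (y' t - x' t)) / (h + x t ^ 2)

/-- Linearized energy of `(y, y')` relative to the orbit point `(x, x')`, divided by `h`. -/
noncomputable def energyCoord (h : ℝ) (x x' y y' : ℝ → ℝ) (t : ℝ) : ℝ :=
  (x' t * (y' t - x' t) - (x t - x t ^ 3) * (y t - x t)) / h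

/-- Nonlinear remainder of the cubic force. -/
def cubicRemainder (x y : ℝ → ℝ) (t : ℝ) : ℝ :=
  -(3 * x t * (y t - x t) ^ 2 + (y t - x t) ^ 3)

/-- Derivative of the energy coordinate in terms of the coordinates. -/
noncomputable def energyRate (T h : ℝ) (x x' y : ℝ → ℝ) (ψ b : ℝ → ℝ) (t : ℝ) : ℝ :=
  -(x' t ^ 2 / h) * (ψ t - ψ (t - T)) - x t * x' t / (h + x t ^ 2) * (b t - b (t - T))
    + x' t * cubicRemainder x y t / h

/-- Derivative of the phase coordinate in terms of the coordinates. -/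
noncomputable def phaseRate (T h : ℝ) (x x' y : ℝ → ℝ) (ψ b : ℝ → ℝ) (t : ℝ) : ℝ :=
  h * (h + 3 * x t ^ 2) / (h + x t ^ 2) ^ 2 * b t
    + x t * x' t / (h + x t ^ 2) * (ψ t - ψ (t - T))
    + h * x t ^ 2 / (h + x t ^ 2) ^ 2 * (b t - b (t - T))
    - x t * cubicRemainder x y t / (h + x t ^ 2)

namespace IsDuffingOrbit

variable {T h : ℝ} {x x' y y' : ℝ → ℝ}

lemma sub_eq (hx : IsDuffingOrbit T h x x') (hh : 0 < h) (y y' : ℝ → ℝ) (t : ℝ) :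
    y t - x t = phaseCoord h x x' y y' t * x' t
      + h / (h + x t ^ 2) * x t * energyCoord h x x' y y' t := by
  have hN : h + x t ^ 2 ≠ 0 := by positivity
  have he := hx.energy t
  simp only [phaseCoord, energyCoord]
  field_simp
  linear_combination (x t - y t) * he

lemma deriv_sub_eq (hx : IsDuffingOrbit T h x x') (hh : 0 < h) (y y' : ℝ → ℝ) (t : ℝ) :
    y' t - x' t = phaseCoord h x x' y y' t * (x t - x t ^ 3)
      + 2 * (h / (h + x t ^ 2)) * x' t * energyCoord h x x' y y' t := by
  have hN : h + x t ^ 2 ≠ 0 := by positivity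
  have he := hx.energy t
  simp only [phaseCoord, energyCoord]
  field_simp
  linear_combination (x' t - y' t) * he

lemma add_delayed_eq (hx : IsDuffingOrbit T h x x') (hh : 0 < h) (y y' : ℝ → ℝ) (t : ℝ) :
    y t - x t + (y (t - T) - x (t - T))
      = x' t * (phaseCoord h x x' y y' t - phaseCoord h x x' y y' (t - T))
      + h / (h + x t ^ 2) * x t
        * (energyCoord h x x' y y' t - energyCoord h x x' y y' (t - T)) := by
  rw [hx.sub_eq hh y y' t, hx.sub_eq hh y y' (t - T), hx.antiperiodic, hx.antiperiodic', neg_sq]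
  ring

lemma hasDerivAt_energyCoord (hx : IsDuffingOrbit T h x x') (hh : 0 < h)
    (hy : IsDelayedDuffing T y y') {t : ℝ} (ht : 0 < t) :
    HasDerivAt (energyCoord h x x' y y')
      (energyRate T h x x' y (phaseCoord h x x' y y') (energyCoord h x x' y y') t) t := by
  have hN : h + x t ^ 2 ≠ 0 := by positivity
  have d1 := hx.hasDerivAt t
  have d2 := hx.hasDerivAt' t
  have d3 := hy.hasDerivAt t ht
  have d4 := hy.hasDerivAt' t ht
  have hw := hx.add_delayed_eq hh y y' t
  refine (((d2.fun_mul (d4.fun_sub d2)).fun_sub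
    ((d1.fun_sub (d1.fun_pow 3)).fun_mul (d3.fun_sub d1))).div_const h).congr_deriv ?_
  have e : y (t - T) = -(y t - x t) + x (t - T)
    + (x' t * (phaseCoord h x x' y y' t - phaseCoord h x x' y y' (t - T))
      + h / (h + x t ^ 2) * x t
        * (energyCoord h x x' y y' t - energyCoord h x x' y y' (t - T))) := by
    rw [← hw]; ring
  rw [e, hx.antiperiodic]
  simp only [energyRate, cubicRemainder]
  field_simp
  ring

lemma hasDerivAt_phaseCoord (hx : IsDuffingOrbit T h x x') (hh : 0 < h)
    (hy : IsDelayedDuffing T y y') {t : ℝ} (ht : 0 < t) :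
    HasDerivAt (phaseCoord h x x' y y')
      (phaseRate T h x x' y (phaseCoord h x x' y y') (energyCoord h x x' y y') t) t := by
  have hN : h + x t ^ 2 ≠ 0 := by positivity
  have d1 := hx.hasDerivAt t
  have d2 := hx.hasDerivAt' t
  have d3 := hy.hasDerivAt t ht
  have d4 := hy.hasDerivAt' t ht
  have hw := hx.add_delayed_eq hh y y' t
  refine ((((d2.const_mul 2).fun_mul (d3.fun_sub d1)).fun_sub
    (d1.fun_mul (d4.fun_sub d2))).fun_div ((d1.fun_pow 2).const_add h) hN).congr_deriv ?_
  have e : y (t - T) = -(y t - x t) + x (t - T)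
    + (x' t * (phaseCoord h x x' y y' t - phaseCoord h x x' y y' (t - T))
      + h / (h + x t ^ 2) * x t
        * (energyCoord h x x' y y' t - energyCoord h x x' y y' (t - T))) := by
    rw [← hw]; ring
  have he := hx.energy t
  rw [e, hx.antiperiodic]
  simp only [phaseRate, cubicRemainder]
  have e4 : y t = x t + (y t - x t) := by ring
  clear e hw
  generalize phaseCoord h x x' y y' (t - T) = η at *
  generalize energyCoord h x x' y y' (t - T) = bT at *
  generalize hwt : y t - x t = w at *
  generalize hqt : y' t - x' t = q at *
  rw [e4, show phaseCoord h x x' y y' t = (2 * x' t * w - x t * q) / (h + x t ^ 2) by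
      rw [phaseCoord, hwt, hqt],
    show energyCoord h x x' y y' t = (x' t * q - (x t - x t ^ 3) * w) / h by
      rw [energyCoord, hwt, hqt]]
  field_simp
  rw [← he]
  ring

end IsDuffingOrbit

namespace IsDuffingOrbit

variable {T h s φ L : ℝ} {x x' y y' : ℝ → ℝ}

lemma abs_energyRate_le (hh : 0 < h)
    {t : ℝ} (hs : |x t * x' t| ≤ s * h) (hx' : x' t ^ 2 ≤ h)
    (hf : |x' t * cubicRemainder x y t| ≤ φ * h) (ψ b : ℝ → ℝ) :
    |energyRate T h x x' y ψ b t| ≤ |ψ t - ψ (t - T)| + s * (|b t| + |b (t - T)|) + φ := by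
  have hN : h ≤ h + x t ^ 2 := by nlinarith [sq_nonneg (x t)]
  have hN0 : 0 < h + x t ^ 2 := hh.trans_le hN
  have h1 : |-(x' t ^ 2 / h) * (ψ t - ψ (t - T))| ≤ |ψ t - ψ (t - T)| := by
    rw [abs_mul, abs_neg, abs_of_nonneg (by positivity)]
    exact mul_le_of_le_one_left (abs_nonneg _) ((div_le_one hh).2 hx')
  have h2 : |x t * x' t / (h + x t ^ 2) * (b t - b (t - T))| ≤ s * (|b t| + |b (t - T)|) := by
    have hc : |x t * x' t / (h + x t ^ 2)| ≤ s := by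
      rw [abs_div, abs_of_pos hN0, div_le_iff₀ hN0]
      have : 0 ≤ s := nonneg_of_mul_nonneg_left ((abs_nonneg _).trans hs) hh
      exact hs.trans (by gcongr)
    rw [abs_mul]
    exact mul_le_mul hc (abs_sub _ _) (abs_nonneg _) ((abs_nonneg _).trans hc)
  have h3 : |x' t * cubicRemainder x y t / h| ≤ φ := by
    rw [abs_div, abs_of_pos hh, div_le_iff₀ hh]; exact hf
  rw [energyRate]
  exact (abs_add_le _ _).trans (add_le_add ((abs_sub _ _).trans (add_le_add h1 h2)) h3)

lemma abs_phaseRate_sub_le (hh : 0 < h)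
    {t : ℝ} (hs : |x t * x' t| ≤ s * h) (hx2 : x t ^ 2 ≤ s * h)
    (hf : |x t * cubicRemainder x y t| ≤ φ * h) (ψ b : ℝ → ℝ) :
    |phaseRate T h x x' y ψ b t - b t|
      ≤ s * (|ψ t - ψ (t - T)| + 2 * |b t| + |b (t - T)|) + φ := by
  have hN : h ≤ h + x t ^ 2 := by nlinarith [sq_nonneg (x t)]
  have hN0 : 0 < h + x t ^ 2 := hh.trans_le hN
  have hs0 : 0 ≤ s := nonneg_of_mul_nonneg_left ((abs_nonneg _).trans hs) hh
  have h1 : |(h * (h + 3 * x t ^ 2) / (h + x t ^ 2) ^ 2 - 1) * b t| ≤ s * |b t| := by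
    rw [abs_mul]
    refine mul_le_mul_of_nonneg_right ?_ (abs_nonneg _)
    rw [show h * (h + 3 * x t ^ 2) / (h + x t ^ 2) ^ 2 - 1
      = x t ^ 2 * (h - x t ^ 2) / (h + x t ^ 2) ^ 2 by field_simp; ring,
      abs_div, abs_of_pos (pow_pos hN0 2), div_le_iff₀ (pow_pos hN0 2), abs_mul,
      abs_of_nonneg (sq_nonneg (x t))]
    have : |h - x t ^ 2| ≤ h + x t ^ 2 := abs_le.2 ⟨by nlinarith, by nlinarith⟩
    calc x t ^ 2 * |h - x t ^ 2| ≤ (s * (h + x t ^ 2)) * (h + x t ^ 2) := by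
          gcongr; exact hx2.trans (by gcongr)
      _ = _ := by ring
  have h2 : |x t * x' t / (h + x t ^ 2) * (ψ t - ψ (t - T))| ≤ s * |ψ t - ψ (t - T)| := by
    rw [abs_mul]
    refine mul_le_mul_of_nonneg_right ?_ (abs_nonneg _)
    rw [abs_div, abs_of_pos hN0, div_le_iff₀ hN0]
    exact hs.trans (by gcongr)
  have h3 : |h * x t ^ 2 / (h + x t ^ 2) ^ 2 * (b t - b (t - T))| ≤ s * (|b t| + |b (t - T)|) := by
    rw [abs_mul]
    refine mul_le_mul ?_ (abs_sub _ _) (abs_nonneg _) hs0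
    rw [abs_of_nonneg (by positivity), div_le_iff₀ (pow_pos hN0 2)]
    calc h * x t ^ 2 ≤ (h + x t ^ 2) * (s * (h + x t ^ 2)) := by
          gcongr; exact hx2.trans (by gcongr)
      _ = _ := by ring
  have h4 : |x t * cubicRemainder x y t / (h + x t ^ 2)| ≤ φ := by
    have hφ : 0 ≤ φ := nonneg_of_mul_nonneg_left ((abs_nonneg _).trans hf) hh
    rw [abs_div, abs_of_pos hN0, div_le_iff₀ hN0]; exact hf.trans (by gcongr)
  rw [phaseRate, show ∀ A B C D E : ℝ, A * E + B + C - D - E = (A - 1) * E + B + C - D by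
    intros; ring]
  refine ((abs_sub _ _).trans (add_le_add_left ((abs_add_le _ _).trans
    (add_le_add_left (abs_add_le _ _) _)) _)).trans ?_
  linarith

lemma continuous_phaseCoord (hx : IsDuffingOrbit T h x x') (hh : 0 < h)
    (hy : IsDelayedDuffing T y y') : Continuous (phaseCoord h x x' y y') := by
  have := hx.continuous
  have := hx.continuous'
  have := hy.continuous
  have := hy.continuous'
  unfold phaseCoord
  exact Continuous.div (by fun_prop) (by fun_prop) fun t => by positivity

lemma continuous_energyCoord (hx : IsDuffingOrbit T h x x')
    (hy : IsDelayedDuffing T y y') : Continuous (energyCoord h x x' y y') := by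
  have := hx.continuous
  have := hx.continuous'
  have := hy.continuous
  have := hy.continuous'
  unfold energyCoord
  fun_prop

/-- A solution of the delayed equation near a small orbit is a slow system in the phase and energy
coordinates. -/
theorem isSlowSystem (hx : IsDuffingOrbit T h x x') (hy : IsDelayedDuffing T y y') (hT : 0 < T)
    (hs1 : s ≤ 1 / 2) (hh : 1 ≤ h) (hsmall : ∀ t, x t ^ 2 ≤ s * h ∧ |x t * x' t| ≤ s * h)
    (hf : ∀ t ∈ Set.Ioo 0 L, |x t * cubicRemainder x y t| ≤ φ * h ∧
      |x' t * cubicRemainder x y t| ≤ φ * h) :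
    ∃ c v' : ℝ → ℝ, IsSlowSystem T (3 * s) (2 * φ) L
      (phaseCoord h x x' y y')
      (phaseRate T h x x' y (phaseCoord h x x' y y') (energyCoord h x x' y y'))
      (energyCoord h x x' y y')
      (energyRate T h x x' y (phaseCoord h x x' y y') (energyCoord h x x' y y')) c v' := by
  have hh0 : 0 < h := by linarith
  have hs0 : 0 ≤ s := nonneg_of_mul_nonneg_left ((sq_nonneg _).trans (hsmall 0).1) hh0
  have hφ0 : ∀ t ∈ Set.Ioo 0 L, 0 ≤ φ := fun t ht =>
    nonneg_of_mul_nonneg_left ((abs_nonneg _).trans (hf t ht).1) hh0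
  have hx' : ∀ t, x' t ^ 2 ≤ h := fun t => by linarith [hx.deriv_sq_le t]
  have dψ := fun t (ht : 0 < t) => hx.hasDerivAt_phaseCoord hh0 hy ht
  have db := fun t (ht : 0 < t) => hx.hasDerivAt_energyCoord hh0 hy ht
  have cψ := hx.continuous_phaseCoord hh0 hy
  have cb := hx.continuous_energyCoord hy
  have bψ := fun t (ht : t ∈ Set.Ioo 0 L) => abs_phaseRate_sub_le (T := T) hh0 (hsmall t).2
    (hsmall t).1 (hf t ht).1 (phaseCoord h x x' y y') (energyCoord h x x' y y')
  have bb := fun t (ht : t ∈ Set.Ioo 0 L) => abs_energyRate_le (T := T) hh0 (hsmall t).2 (hx' t)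
    (hf t ht).2 (phaseCoord h x x' y y') (energyCoord h x x' y y')
  have rate_eq : ∀ t, energyRate T h x x' y (phaseCoord h x x' y y') (energyCoord h x x' y y') t
      = -(x' t ^ 2 / h) * (phaseCoord h x x' y y' t - phaseCoord h x x' y y' (t - T))
        + (-(x t * x' t / (h + x t ^ 2) * (energyCoord h x x' y y' t
          - energyCoord h x x' y y' (t - T))) + x' t * cubicRemainder x y t / h) := by
    intro t; rw [energyRate]; ring
  have bb2 : ∀ t ∈ Set.Ioo 0 L, |-(x t * x' t / (h + x t ^ 2) * (energyCoord h x x' y y' t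
          - energyCoord h x x' y y' (t - T))) + x' t * cubicRemainder x y t / h|
      ≤ s * (|energyCoord h x x' y y' t| + |energyCoord h x x' y y' (t - T)|) + φ := by
    intro t ht
    have := abs_energyRate_le (T := T) (y := y) hh0 (hsmall t).2 (hx' t) (hf t ht).2
      (fun _ => 0) (energyCoord h x x' y y')
    simp only [energyRate, sub_self, mul_zero, zero_sub, abs_zero, zero_add] at this
    exact this
  generalize phaseRate T h x x' y (phaseCoord h x x' y y') (energyCoord h x x' y y') = ψ' at *
  generalize energyRate T h x x' y (phaseCoord h x x' y y') (energyCoord h x x' y y') = b' at *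
  generalize phaseCoord h x x' y y' = ψ at *
  generalize energyCoord h x x' y y' = b at *
  have hcx := hx.continuous
  have hcx' := hx.continuous'
  have hc : ∀ t, |x t * x' t / (3 * h)| ≤ s / 3 := fun t => by
    rw [abs_div, abs_of_pos (by positivity : 0 < 3 * h), div_le_iff₀ (by positivity)]
    linarith [(hsmall t).2]
  refine ⟨fun t => x t * x' t / (3 * h), fun t => b' t
    + (x' t ^ 2 + x t * (x t - x t ^ 3)) / (3 * h) * (ψ t - ψ (t - T))
    + x t * x' t / (3 * h) * (ψ' t - ψ' (t - T)),
    cψ, cb, by fun_prop, fun t => (hc t).trans (by linarith), fun t ht => dψ t ht.1,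
    fun t ht => db t ht.1, fun t ht => ?_, fun t ht => ?_, fun t ht => ?_, fun t ht => ?_⟩
  · have := hφ0 t ht
    refine (bψ t ht).trans ?_
    nlinarith [mul_nonneg hs0 (abs_nonneg (ψ t - ψ (t - T))), mul_nonneg hs0 (abs_nonneg (b t)),
      mul_nonneg hs0 (abs_nonneg (b (t - T)))]
  · have := hφ0 t ht
    refine (bb t ht).trans ?_
    nlinarith [mul_nonneg hs0 (abs_nonneg (b t)), mul_nonneg hs0 (abs_nonneg (b (t - T)))]
  · have d1 := dψ t (hT.trans ht.1)
    have d2 := (dψ (t - T) (sub_pos.2 ht.1)).comp_sub_const t T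
    refine ((db t (hT.trans ht.1)).fun_add ((((hx.hasDerivAt t).fun_mul
      (hx.hasDerivAt' t)).div_const (3 * h)).fun_mul (d1.fun_sub d2))).congr_deriv ?_
    ring
  · have ht1 : t ∈ Set.Ioo 0 L := ⟨hT.trans ht.1, ht.2⟩
    have ht2 : t - T ∈ Set.Ioo 0 L := ⟨sub_pos.2 ht.1, by linarith [ht.2]⟩
    have hφ := hφ0 t ht1
    have k1 := bψ t ht1
    have k2 := bψ (t - T) ht2
    have k3 := bb2 t ht1
    have k4 : |x t ^ 2 / (3 * h) * (ψ t - ψ (t - T))| ≤ s / 3 * |ψ t - ψ (t - T)| := by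
      rw [abs_mul]
      refine mul_le_mul_of_nonneg_right ?_ (abs_nonneg _)
      rw [abs_of_nonneg (by positivity), div_le_iff₀ (by positivity)]
      linarith [(hsmall t).1]
    have k5 : |x t * x' t / (3 * h) * (ψ' t - ψ' (t - T))| ≤ s / 3 * (|ψ' t| + |ψ' (t - T)|) := by
      rw [abs_mul]
      exact mul_le_mul (hc t) (abs_sub _ _) (abs_nonneg _) (by linarith)
    have k6 := abs_sub_abs_le_abs_sub (ψ' t) (b t)
    have k7 := abs_sub_abs_le_abs_sub (ψ' (t - T)) (b (t - T))
    have e : b' t + (x' t ^ 2 + x t * (x t - x t ^ 3)) / (3 * h) * (ψ t - ψ (t - T))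
        + x t * x' t / (3 * h) * (ψ' t - ψ' (t - T)) + 1 / 3 * (ψ t - ψ (t - T))
        = (-(x t * x' t / (h + x t ^ 2) * (b t - b (t - T))) + x' t * cubicRemainder x y t / h)
          - x t ^ 2 / (3 * h) * (ψ t - ψ (t - T))
          + x t * x' t / (3 * h) * (ψ' t - ψ' (t - T)) := by
      rw [rate_eq t]
      have he := hx.energy t
      generalize x t * x' t / (h + x t ^ 2) * (b t - b (t - T)) = Q
      field_simp
      linear_combination (-(ψ t - ψ (t - T))) * he
    rw [e]
    refine ((abs_add_le _ _).trans (add_le_add_left (abs_sub _ _) _)).trans ?_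
    have a1 := abs_nonneg (ψ t - ψ (t - T))
    have a2 := abs_nonneg (ψ (t - T) - ψ (t - T - T))
    have a3 := abs_nonneg (b t)
    have a4 := abs_nonneg (b (t - T))
    have a5 := abs_nonneg (b (t - T - T))
    generalize |ψ t - ψ (t - T)| = A1 at *
    generalize |ψ (t - T) - ψ (t - T - T)| = A2 at *
    generalize |b t| = A3 at *
    generalize |b (t - T)| = A4 at *
    generalize |b (t - T - T)| = A5 at *
    have h1 : s * (A1 + 2 * A3 + A4) ≤ 1 / 2 * (A1 + 2 * A3 + A4) := by gcongr
    have h2 : s * (A2 + 2 * A4 + A5) ≤ 1 / 2 * (A2 + 2 * A4 + A5) := by gcongr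
    have h3 : s / 3 * (|ψ' t| + |ψ' (t - T)|)
        ≤ s / 3 * (1 / 2 * (A1 + 2 * A3 + A4) + 1 / 2 * (A2 + 2 * A4 + A5) + A3 + A4 + 2 * φ) :=
      mul_le_mul_of_nonneg_left (by linarith) (by linarith)
    have h4 : s * φ ≤ 1 / 2 * φ := by gcongr
    nlinarith [mul_nonneg hs0 a1, mul_nonneg hs0 a2, mul_nonneg hs0 a3, mul_nonneg hs0 a4,
      mul_nonneg hs0 a5]

end IsDuffingOrbit

lemma abs_sub_sub_mul_le_of_second_deriv {f f' f'' : ℝ → ℝ} {K : ℝ} (hf : ∀ t, HasDerivAt f (f' t) t)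
    (hf' : ∀ t, HasDerivAt f' (f'' t) t) (hK : ∀ t, |f'' t| ≤ K) (t p : ℝ) :
    |f (t + p) - f t - p * f' t| ≤ K * p ^ 2 := by
  have hK0 : 0 ≤ K := (abs_nonneg _).trans (hK 0)
  have h1 : ∀ s ∈ Set.uIcc t (t + p), ‖f' s - f' t‖ ≤ K * |p| := by
    intro s hs
    have := (convex_univ (𝕜 := ℝ) (E := ℝ)).norm_image_sub_le_of_norm_hasDerivWithin_le
      (fun u _ => (hf' u).hasDerivWithinAt) (fun u _ => hK u) (Set.mem_univ t) (Set.mem_univ s)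
    refine this.trans (mul_le_mul_of_nonneg_left ?_ hK0)
    have := Set.abs_sub_left_of_mem_uIcc hs
    simpa using this
  have h2 := (convex_uIcc t (t + p)).norm_image_sub_le_of_norm_hasDerivWithin_le
    (f := fun s => f s - s * f' t) (f' := fun s => f' s - f' t)
    (fun u _ => ((hf u).fun_sub ((hasDerivAt_id u).mul_const (f' t))).hasDerivWithinAt.congr_deriv
      (by simp)) h1 Set.left_mem_uIcc Set.right_mem_uIcc
  simp only [Real.norm_eq_abs, add_sub_cancel_left] at h2
  rw [show f (t + p) - f t - p * f' t = f (t + p) - (t + p) * f' t - (f t - t * f' t) by ring,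
    ← sq_abs p]
  linarith

namespace IsDuffingOrbit

variable {T h : ℝ} {x x' y y' : ℝ → ℝ}

lemma bounds (hx : IsDuffingOrbit T h x x') (hh : 1 ≤ h) (t : ℝ) :
    |x t| ≤ 4 * (2 + h) ^ 2 ∧ |x' t| ≤ 4 * (2 + h) ^ 2 ∧ |x t - x t ^ 3| ≤ 4 * (2 + h) ^ 2 ∧
      |(1 - 3 * x t ^ 2) * x' t| ≤ 4 * (2 + h) ^ 2 := by
  have h1 : x t ^ 2 ≤ 2 + h := by
    have := hx.sq_le t
    have : Real.sqrt (h + 1) ≤ h + 1 := Real.sqrt_le_iff.2 ⟨by linarith, by nlinarith⟩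
    linarith
  have h2 : x' t ^ 2 ≤ 2 + h := by linarith [hx.deriv_sq_le t]
  have h3 : |x t| ≤ 2 + h := abs_le_of_sq_le_sq (by nlinarith) (by linarith)
  have h4 : |x' t| ≤ 2 + h := abs_le_of_sq_le_sq (by nlinarith) (by linarith)
  have h5 : 2 + h ≤ (2 + h) ^ 2 := by nlinarith
  refine ⟨by linarith, by linarith, ?_, ?_⟩
  · rw [show x t - x t ^ 3 = x t * (1 - x t ^ 2) by ring, abs_mul]
    have : |1 - x t ^ 2| ≤ 2 + h := abs_le.2 ⟨by linarith, by linarith [sq_nonneg (x t)]⟩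
    nlinarith [mul_le_mul h3 this (abs_nonneg _) (by linarith)]
  · rw [abs_mul]
    have : |1 - 3 * x t ^ 2| ≤ 3 * (2 + h) := abs_le.2 ⟨by linarith, by linarith [sq_nonneg (x t)]⟩
    nlinarith [mul_le_mul this h4 (abs_nonneg _) (by linarith)]

/-- Gronwall bound for the distance to an orbit, linear in the initial distance. -/
lemma abs_sub_le (hx : IsDuffingOrbit T h x x') (hy : IsDelayedDuffing T y y') (hT : 0 < T)
    {K ε L : ℝ} (hK : 1 ≤ K) (hxK : ∀ t, |x t| ≤ K) (hε : 0 < ε) (hε1 : ε ≤ 1) (hL : 0 ≤ L)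
    (hinit : ∀ t ∈ Set.Icc (-T) 0, |y t - x t| + |y' t - x' t| ≤ ε) {t : ℝ}
    (ht : t ∈ Set.Icc (-T) L) :
    |y t - x t| ≤ 2 * Real.exp (22 * K ^ 2 * L) * (1 + 11 * K ^ 2 * T) * ε ∧
      |y' t - x' t| ≤ 2 * Real.exp (22 * K ^ 2 * L) * (1 + 11 * K ^ 2 * T) * ε := by
  set G := 2 * Real.exp (22 * K ^ 2 * L) * (1 + 11 * K ^ 2 * T) with hG
  have hG1 : 1 ≤ G := by
    have h1 : 1 ≤ Real.exp (22 * K ^ 2 * L) := Real.one_le_exp (by positivity)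
    have h2 : 0 ≤ 11 * K ^ 2 * T := by positivity
    nlinarith
  have hc1 := hx.continuous
  have hc2 := hx.continuous'
  have hc3 := hy.continuous
  have hc4 := hy.continuous'
  have hinit' : ∀ t ∈ Set.Icc (-T) 0, |y t - x t| ≤ ε ∧ |y' t - x' t| ≤ ε := fun t ht =>
    ⟨by linarith [hinit t ht, abs_nonneg (y' t - x' t)],
      by linarith [hinit t ht, abs_nonneg (y t - x t)]⟩
  rcases le_total t 0 with ht0 | ht0
  · obtain ⟨h1, h2⟩ := hinit' t ⟨ht.1, ht0⟩
    exact ⟨h1.trans (le_mul_of_one_le_left hε.le hG1), h2.trans (le_mul_of_one_le_left hε.le hG1)⟩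
  have key := le_of_delay_gronwall (K := 11 * K ^ 2) (T := T) (φ := 0) (m := ε ^ 2) (L := L)
    (E := fun t => (y' t - x' t) ^ 2 / 2 + (y t - x t) ^ 2 / 2 + (y t - x t) ^ 4 / 4)
    (E' := fun t => (y' t - x' t) * ((y t - x t) - (y (t - T) - x (t - T))
      - 3 * x t ^ 2 * (y t - x t) - 3 * x t * (y t - x t) ^ 2))
    (by positivity) hT.le le_rfl (by fun_prop) (fun _ _ => by positivity) ?_ ?_ ?_ ⟨ht0, ht.2⟩
  · have hb : Real.exp (2 * (11 * K ^ 2) * t) * ((1 + 11 * K ^ 2 * T) * ε ^ 2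
        + 0 / (2 * (11 * K ^ 2))) ≤ G * ε ^ 2 / 2 := by
      rw [hG, zero_div, add_zero, ← mul_assoc, show ∀ a b c : ℝ, 2 * a * b * c / 2 = a * b * c by
        intros; ring]
      have : 2 * (11 * K ^ 2) * t ≤ 22 * K ^ 2 * L := by
        nlinarith [mul_le_mul_of_nonneg_left ht.2 (sq_nonneg K)]
      gcongr
    have hGe : G * ε ^ 2 ≤ (G * ε) ^ 2 := by nlinarith [sq_nonneg ε]
    have k := key.trans hb
    have q4 : 0 ≤ (y t - x t) ^ 4 := by positivity
    exact ⟨abs_le_of_sq_le_sq (by nlinarith [sq_nonneg (y' t - x' t)]) (by positivity),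
      abs_le_of_sq_le_sq (by nlinarith [sq_nonneg (y t - x t)]) (by positivity)⟩
  · intro u hu
    have h0 := hinit u hu
    have a1 := abs_nonneg (y u - x u)
    have a2 := abs_nonneg (y' u - x' u)
    have h1 : |y u - x u| ^ 2 + |y' u - x' u| ^ 2 ≤ ε ^ 2 := by nlinarith
    simp only [sq_abs] at h1
    have h2 : (y u - x u) ^ 2 ≤ 1 := by nlinarith [sq_nonneg (y' u - x' u)]
    nlinarith [sq_nonneg (y' u - x' u), sq_nonneg (y u - x u)]
  · intro u hu
    have d := ((((hy.hasDerivAt' u hu.1).fun_sub (hx.hasDerivAt' u)).fun_pow 2).div_const 2).fun_add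
      ((((hy.hasDerivAt u hu.1).fun_sub (hx.hasDerivAt u)).fun_pow 2).div_const 2) |>.fun_add
      ((((hy.hasDerivAt u hu.1).fun_sub (hx.hasDerivAt u)).fun_pow 4).div_const 4)
    refine d.congr_deriv ?_
    rw [hx.antiperiodic]
    push_cast
    ring
  · intro u hu
    have hK2 : x u ^ 2 ≤ K ^ 2 := sq_le_sq' (abs_le.1 (hxK u)).1 (abs_le.1 (hxK u)).2
    generalize y' u - x' u = q
    generalize y u - x u = w
    generalize y (u - T) - x (u - T) = wT
    generalize y' (u - T) - x' (u - T) = qT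
    have e1 : q * w * (1 - 3 * x u ^ 2) ≤ 4 * K ^ 2 * ((q ^ 2 + w ^ 2) / 2) := by
      have : |q * w| ≤ (q ^ 2 + w ^ 2) / 2 := abs_le.2
        ⟨by nlinarith [sq_nonneg (q + w)], by nlinarith [sq_nonneg (q - w)]⟩
      have h2 : |1 - 3 * x u ^ 2| ≤ 4 * K ^ 2 :=
        abs_le.2 ⟨by nlinarith, by nlinarith [sq_nonneg (x u)]⟩
      refine (le_abs_self _).trans ?_
      rw [abs_mul, mul_comm]
      gcongr
    have e2 : -(q * wT) ≤ (q ^ 2 + wT ^ 2) / 2 := by nlinarith [sq_nonneg (q + wT)]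
    have e3 : -(3 * x u) * (q * w ^ 2) ≤ 3 * K ^ 2 * ((q ^ 2 + w ^ 4) / 2) := by
      have h1 : |q * w ^ 2| ≤ (q ^ 2 + w ^ 4) / 2 := abs_le.2
        ⟨by nlinarith [sq_nonneg (q + w ^ 2)], by nlinarith [sq_nonneg (q - w ^ 2)]⟩
      have h2 : |-(3 * x u)| ≤ 3 * K ^ 2 := by
        rw [abs_neg, abs_mul, abs_of_pos (by norm_num : (0 : ℝ) < 3)]
        nlinarith [hxK u]
      refine (le_abs_self _).trans ?_
      rw [abs_mul]
      gcongr
    have z1 : 0 ≤ w ^ 4 := by positivity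
    have z2 : 0 ≤ wT ^ 4 := by positivity
    have hK1 : 1 ≤ K ^ 2 := one_le_pow₀ hK
    have z3 : 0 ≤ K ^ 2 * qT ^ 2 := by positivity
    have z4 : 0 ≤ K ^ 2 * wT ^ 4 := by positivity
    have z5 : q ^ 2 ≤ K ^ 2 * q ^ 2 := le_mul_of_one_le_left (sq_nonneg _) hK1
    have z6 : wT ^ 2 ≤ K ^ 2 * wT ^ 2 := le_mul_of_one_le_left (sq_nonneg _) hK1
    have z7 : 0 ≤ K ^ 2 * w ^ 4 := by positivity
    have z8 : 0 ≤ K ^ 2 * w ^ 2 := by positivity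
    have z9 : 0 ≤ K ^ 2 * wT ^ 2 := by positivity
    have z10 : 0 ≤ K ^ 2 * q ^ 2 := by positivity
    nlinarith

lemma abs_coord_le (hh : 1 ≤ h) {K e t : ℝ} (hK : |x t| ≤ K ∧ |x' t| ≤ K ∧ |x t - x t ^ 3| ≤ K)
    (hw : |y t - x t| ≤ e) (hq : |y' t - x' t| ≤ e) :
    |phaseCoord h x x' y y' t| ≤ 3 * K * e ∧ |energyCoord h x x' y y' t| ≤ 2 * K * e := by
  obtain ⟨h1, h2, h3⟩ := hK
  have hK0 : 0 ≤ K := (abs_nonneg _).trans h1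
  have he0 : 0 ≤ e := (abs_nonneg _).trans hw
  have div_le : ∀ {a n c : ℝ}, 1 ≤ n → |a| ≤ c → |a / n| ≤ c := fun {a n c} hn ha => by
    rw [abs_div, abs_of_pos (by linarith : 0 < n)]
    exact (div_le_self (abs_nonneg _) hn).trans ha
  have m1 : |2 * x' t * (y t - x t)| ≤ 2 * K * e := by
    rw [abs_mul, abs_mul, abs_two]; gcongr
  have m2 : |x t * (y' t - x' t)| ≤ K * e := by rw [abs_mul]; gcongr
  have m3 : |x' t * (y' t - x' t)| ≤ K * e := by rw [abs_mul]; gcongr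
  have m4 : |(x t - x t ^ 3) * (y t - x t)| ≤ K * e := by rw [abs_mul]; gcongr
  exact ⟨div_le (by nlinarith [sq_nonneg (x t)]) ((abs_sub _ _).trans (by linarith)),
    div_le hh ((abs_sub _ _).trans (by linarith))⟩

lemma abs_sub_translate_le (hx : IsDuffingOrbit T h x x') (hh : 1 ≤ h) {K : ℝ}
    (hK : ∀ t, |x t| ≤ K ∧ |x' t| ≤ K ∧ |x t - x t ^ 3| ≤ K ∧ |(1 - 3 * x t ^ 2) * x' t| ≤ K)
    {r p t : ℝ} (hψ : |phaseCoord h x x' y y' t - p| ≤ r) (hb : |energyCoord h x x' y y' t| ≤ r) :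
    |y t - x (t + p)| + |y' t - x' (t + p)| ≤ 5 * K * r + 2 * K * p ^ 2 := by
  have hh0 : 0 < h := by linarith
  have e1 := hx.sub_eq hh0 y y' t
  have e2 := hx.deriv_sub_eq hh0 y y' t
  obtain ⟨h1, h2, h3, -⟩ := hK t
  have hK0 : 0 ≤ K := (abs_nonneg _).trans h1
  have hr0 : 0 ≤ r := (abs_nonneg _).trans hb
  generalize phaseCoord h x x' y y' t = ψ at *
  generalize energyCoord h x x' y y' t = b at *
  have t1 := abs_sub_sub_mul_le_of_second_deriv hx.hasDerivAt hx.hasDerivAt'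
    (fun t => (hK t).2.2.1) t p
  have t2 := abs_sub_sub_mul_le_of_second_deriv (f'' := fun t => (1 - 3 * x t ^ 2) * x' t)
    hx.hasDerivAt' (fun t => ((hx.hasDerivAt t).fun_sub ((hx.hasDerivAt t).fun_pow 3)).congr_deriv
      (by push_cast; ring)) (fun t => (hK t).2.2.2) t p
  have hc : |h / (h + x t ^ 2)| ≤ 1 := by
    rw [abs_of_nonneg (by positivity)]
    exact (div_le_one (by positivity)).2 (by nlinarith [sq_nonneg (x t)])
  have m1 : |(ψ - p) * x' t| ≤ r * K := by rw [abs_mul]; gcongr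
  have m2 : |(ψ - p) * (x t - x t ^ 3)| ≤ r * K := by rw [abs_mul]; gcongr
  have m3 : |h / (h + x t ^ 2) * x t * b| ≤ 1 * K * r := by rw [abs_mul, abs_mul]; gcongr
  have m4 : |2 * (h / (h + x t ^ 2)) * x' t * b| ≤ 2 * 1 * K * r := by
    rw [abs_mul, abs_mul, abs_mul, abs_two]; gcongr
  have f1 : y t - x (t + p) = (ψ - p) * x' t + h / (h + x t ^ 2) * x t * b
      - (x (t + p) - x t - p * x' t) := by linear_combination e1
  have f2 : y' t - x' (t + p) = (ψ - p) * (x t - x t ^ 3) + 2 * (h / (h + x t ^ 2)) * x' t * b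
      - (x' (t + p) - x' t - p * (x t - x t ^ 3)) := by linear_combination e2
  rw [f1, f2]
  have g1 := (abs_sub ((ψ - p) * x' t + h / (h + x t ^ 2) * x t * b)
    (x (t + p) - x t - p * x' t)).trans (add_le_add_left (abs_add_le _ _) _)
  have g2 := (abs_sub ((ψ - p) * (x t - x t ^ 3) + 2 * (h / (h + x t ^ 2)) * x' t * b)
    (x' (t + p) - x' t - p * (x t - x t ^ 3))).trans (add_le_add_left (abs_add_le _ _) _)
  linarith

end IsDuffingOrbit

lemma abs_mul_cubicRemainder_le {x y : ℝ → ℝ} {K e a t : ℝ} (hK : 1 ≤ K) (ha : |a| ≤ K)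
    (hx : |x t| ≤ K) (hw : |y t - x t| ≤ e) (he : e ≤ 1) :
    |a * cubicRemainder x y t| ≤ 4 * K ^ 2 * e ^ 2 := by
  have he0 : 0 ≤ e := (abs_nonneg _).trans hw
  have h1 : |cubicRemainder x y t| ≤ 3 * K * e ^ 2 + e ^ 3 := by
    rw [cubicRemainder, abs_neg]
    refine (abs_add_le _ _).trans ?_
    rw [abs_mul, abs_mul, abs_pow, abs_pow, abs_of_pos (by norm_num : (0 : ℝ) < 3)]
    gcongr
  have h2 : e ^ 3 ≤ K * e ^ 2 := by nlinarith [sq_nonneg e]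
  rw [abs_mul]
  calc |a| * |cubicRemainder x y t| ≤ K * (4 * K * e ^ 2) := by
        gcongr; linarith
    _ = _ := by ring

lemma contraction_arith {K C g G ε J r ψ p : ℝ} (hK : 1 ≤ K) (hC : 0 < C) (hg : 0 < g)
    (hgG : g ≤ G) (hJ : 60 * K ^ 2 * g < J) (hJ1 : 1 ≤ J) (hε : 0 < ε) (hε1 : ε ≤ 1)
    (hR : (40 * C * K ^ 3 * G ^ 2 + 2 * K * (6 * K * G + 8 * C * K ^ 2 * G ^ 2) ^ 2) * ε ≤ 1 / 4)
    (hr : r = 3 * K * (g * ε) / J + C * (2 * (4 * K ^ 2 * (G * ε) ^ 2)))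
    (hψ : |ψ| ≤ 3 * K * (G * ε)) (hp : |ψ - p| ≤ r) :
    5 * K * r + 2 * K * p ^ 2 ≤ ε / 2 := by
  have hr1 : 5 * K * r ≤ ε / 4 + 40 * C * K ^ 3 * G ^ 2 * ε ^ 2 := by
    have : 5 * K * (3 * K * (g * ε) / J) ≤ ε / 4 := by
      rw [← mul_div_assoc, div_le_iff₀ (by linarith)]
      nlinarith
    rw [hr, mul_add]
    linarith
  have hrp : r ≤ 3 * K * (G * ε) + 8 * C * K ^ 2 * G ^ 2 * ε := by
    have h1 : 3 * K * (g * ε) / J ≤ 3 * K * (G * ε) := by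
      refine (div_le_self (by positivity) hJ1).trans ?_
      gcongr
    have h2 : 8 * C * K ^ 2 * G ^ 2 * (ε * ε) ≤ 8 * C * K ^ 2 * G ^ 2 * ε := by
      gcongr
      exact mul_le_of_le_one_left hε.le hε1
    rw [hr]
    linarith
  have hpQ : |p| ≤ (6 * K * G + 8 * C * K ^ 2 * G ^ 2) * ε := by
    have h3 := abs_sub_abs_le_abs_sub p ψ
    rw [abs_sub_comm] at h3
    linarith
  have hp2 := sq_le_sq' (abs_le.1 hpQ).1 (abs_le.1 hpQ).2
  have h4 := mul_le_mul_of_nonneg_left hp2 (by positivity : 0 ≤ 2 * K)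
  have h5 := mul_le_mul_of_nonneg_right hR hε.le
  linarith

/-- One contraction step for solutions near a small orbit. -/
theorem exists_contraction_step {T : ℝ} (hT : 0 < T) (hT2 : T ^ 2 < 3 / 2 * Real.pi ^ 2) :
    ∃ s > 0, s ≤ 1 ∧ ∀ h : ℝ, 16 / s ^ 4 ≤ h + 1 → ∃ L > 0, ∃ G > 0, ∃ ε₀ > 0,
      ∀ x x' y y' : ℝ → ℝ, IsDuffingOrbit T h x x' → IsDelayedDuffing T y y' →
      ∀ ε : ℝ, 0 < ε → ε ≤ ε₀ → (∀ t ∈ Set.Icc (-T) 0, |y t - x t| + |y' t - x' t| ≤ ε) →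
      (∀ t ∈ Set.Icc (-T) L, |y t - x t| ≤ G * ε ∧ |y' t - x' t| ≤ G * ε) ∧
      ∃ p, ∀ t ∈ Set.Icc (L - T) L, |y t - x (t + p)| + |y' t - x' (t + p)| ≤ ε / 2 := by
  obtain ⟨J, hJ, σ, hσ, hσ1, C, hC, key⟩ := IsSlowSystem.iterated_contraction hT hT2
  refine ⟨σ / 3, by positivity, by linarith, fun h hh => ?_⟩
  have hh1 : 1 ≤ h := by
    have h1 : (σ / 3) ^ 4 ≤ 1 := pow_le_one₀ (by positivity) (by linarith)
    have : 16 ≤ 16 / (σ / 3) ^ 4 := le_div_self (by norm_num) (by positivity) h1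
    linarith
  obtain ⟨K, hKdef⟩ : ∃ K, K = 4 * (2 + h) ^ 2 := ⟨_, rfl⟩
  have hK : 1 ≤ K := by nlinarith
  obtain ⟨g, hg⟩ : ∃ g : ℝ → ℝ,
    ∀ L, g L = 2 * Real.exp (22 * K ^ 2 * L) * (1 + 11 * K ^ 2 * T) := ⟨_, fun _ => rfl⟩
  have hgpos : ∀ L, 0 < g L := fun L => by rw [hg]; positivity
  obtain ⟨j, hj⟩ := pow_unbounded_of_one_lt (60 * K ^ 2 * g T) (one_lt_two)
  obtain ⟨L, hL⟩ : ∃ L, L = ((j : ℝ) * J + 1) * T := ⟨_, rfl⟩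
  have hLT : T ≤ L := hL ▸ le_mul_of_one_le_left hT.le (by
    have : (0 : ℝ) ≤ (j : ℝ) * J := by positivity
    linarith)
  have hgT : g T ≤ g L := by
    rw [hg, hg]
    gcongr
  obtain ⟨G, hG⟩ : ∃ G, G = g L := ⟨_, rfl⟩
  have hG0 : 0 < G := hG ▸ hgpos L
  rw [← hG] at hgT
  obtain ⟨R, hR⟩ : ∃ R, R = 40 * C * K ^ 3 * G ^ 2
    + 2 * K * (6 * K * G + 8 * C * K ^ 2 * G ^ 2) ^ 2 := ⟨_, rfl⟩
  have hR0 : 0 < R := by rw [hR]; positivity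
  refine ⟨L, by linarith, G, hG0, min 1 (min (1 / G) (1 / (4 * R))), by positivity,
    fun x x' y y' hx hy ε hε hεle hinit => ?_⟩
  obtain ⟨hε1, hεG, hεR⟩ : ε ≤ 1 ∧ G * ε ≤ 1 ∧ R * ε ≤ 1 / 4 := by
    simp only [le_min_iff] at hεle
    refine ⟨hεle.1, ?_, ?_⟩
    · have := (le_div_iff₀ hG0).1 hεle.2.1; linarith
    · have := (le_div_iff₀ (by positivity)).1 hεle.2.2; linarith
  have hb := hx.bounds hh1
  rw [← hKdef] at hb
  rw [hR] at hεR
  have hnear := fun t ht => hx.abs_sub_le hy hT hK (fun t => (hb t).1) hε hε1 (by linarith) hinit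
    (L := L) (t := t) ht
  simp only [← hg, ← hG] at hnear
  have hnearT := fun t ht => hx.abs_sub_le hy hT hK (fun t => (hb t).1) hε hε1 hT.le hinit
    (L := T) (t := t) ht
  simp only [← hg] at hnearT
  refine ⟨hnear, ?_⟩
  obtain ⟨-, hsmall⟩ := hx.small (s := σ / 3) (by positivity) (by linarith) hh
  obtain ⟨c, v', hsys⟩ := hx.isSlowSystem (L := L) (φ := 4 * K ^ 2 * (G * ε) ^ 2) hy hT
    (by linarith) hh1 hsmall fun t ht => by
      have hw := (hnear t ⟨by linarith [ht.1], ht.2.le⟩).1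
      have hφ : 4 * K ^ 2 * (G * ε) ^ 2 ≤ 4 * K ^ 2 * (G * ε) ^ 2 * h :=
        le_mul_of_one_le_right (by positivity) hh1
      exact ⟨(abs_mul_cubicRemainder_le hK (hb t).1 (hb t).1 hw hεG).trans hφ,
        (abs_mul_cubicRemainder_le hK (hb t).2.1 (hb t).1 hw hεG).trans hφ⟩
  rw [mul_div_cancel₀ σ (by norm_num : (3 : ℝ) ≠ 0)] at hsys
  obtain ⟨p, hp⟩ := key j (2 * (4 * K ^ 2 * (G * ε) ^ 2)) (3 * K * (g T * ε)) _ _ _ _ _ _ (by positivity)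
    (by have := hgpos T; positivity) (hL ▸ hsys) fun t ht => by
      obtain ⟨hw, hq⟩ := hnearT t ht
      obtain ⟨h1, h2⟩ := IsDuffingOrbit.abs_coord_le hh1 ⟨(hb t).1, (hb t).2.1, (hb t).2.2.1⟩ hw hq
      exact ⟨h1, h2.trans (mul_le_mul_of_nonneg_right (by linarith) (mul_pos (hgpos T) hε).le)⟩
  refine ⟨p, fun t ht => ?_⟩
  have hwin : ∀ t ∈ Set.Icc (L - T) L, t ∈ Set.Icc ((j : ℝ) * J * T - T) (j * J * T + T) := by
    intro t ht
    have : L = j * J * T + T := by rw [hL]; ring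
    exact ⟨by linarith [ht.1], by linarith [ht.2]⟩
  have hLmem : L ∈ Set.Icc (-T) L := ⟨by linarith, le_rfl⟩
  obtain ⟨hw, hq⟩ := hnear L hLmem
  obtain ⟨hψ, -⟩ := IsDuffingOrbit.abs_coord_le hh1 ⟨(hb L).1, (hb L).2.1, (hb L).2.2.1⟩ hw hq
  have hψp := (hp L (hwin L ⟨by linarith, le_rfl⟩)).1
  obtain ⟨h1, h2⟩ := hp t (hwin t ht)
  exact (hx.abs_sub_translate_le hh1 hb h1 h2).trans (contraction_arith hK hC (hgpos T) hgT hj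
    (one_le_pow₀ one_le_two) hε hε1 hεR rfl hψ hψp)

/-- Orbital asymptotic stability of orbits of large energy. -/
theorem exists_orbitally_stable {T : ℝ} (hT : 0 < T) (hT2 : T ^ 2 < 3 / 2 * Real.pi ^ 2) :
    ∃ s > 0, s ≤ 1 ∧ ∀ h : ℝ, 16 / s ^ 4 ≤ h + 1 → ∀ δ > 0, ∃ ε > 0,
      ∀ x x' y y' : ℝ → ℝ, IsDuffingOrbit T h x x' → IsDelayedDuffing T y y' →
      (∀ t ∈ Set.Icc (-T) 0, |y t - x t| + |y' t - x' t| ≤ ε) →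
      (∀ t ≥ 0, Metric.infDist (y t, y' t) (Set.range fun s => (x s, x' s)) < δ) ∧
      Tendsto (fun t => Metric.infDist (y t, y' t) (Set.range fun s => (x s, x' s)))
        atTop (nhds 0) := by
  obtain ⟨s, hs, hs1, key⟩ := exists_contraction_step hT hT2
  refine ⟨s, hs, hs1, fun h hh δ hδ => ?_⟩
  obtain ⟨L, hL, G, hG, ε₀, hε₀, step⟩ := key h hh
  refine ⟨min ε₀ (δ / (2 * G)), by positivity, fun x x' y y' hx hy hinit => ?_⟩
  obtain ⟨ε, hεdef⟩ : ∃ ε, ε = min ε₀ (δ / (2 * G)) := ⟨_, rfl⟩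
  rw [← hεdef] at hinit
  have hε : 0 < ε := by rw [hεdef]; positivity
  have hle : ε ≤ ε₀ := hεdef ▸ min_le_left _ _
  have hGε : G * ε < δ := by
    have : ε ≤ δ / (2 * G) := hεdef ▸ min_le_right _ _
    rw [le_div_iff₀ (by positivity)] at this
    nlinarith
  have step' : ∀ (k : ℕ) (τ : ℝ), (∀ t ∈ Set.Icc (-T) 0,
      |y (t + k * L) - x (t + τ)| + |y' (t + k * L) - x' (t + τ)| ≤ ε / 2 ^ k) → _ := fun k τ hk =>
    step _ _ _ _ (hx.translate τ) (hy.translate (τ := k * L) (by positivity)) (ε / 2 ^ k)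
      (by positivity) ((div_le_self hε.le (one_le_pow₀ one_le_two)).trans hle) hk
  have hind : ∀ k : ℕ, ∃ τ, ∀ t ∈ Set.Icc (-T) 0,
      |y (t + k * L) - x (t + τ)| + |y' (t + k * L) - x' (t + τ)| ≤ ε / 2 ^ k := by
    intro k
    induction k with
    | zero => exact ⟨0, by simpa using hinit⟩
    | succ k ih =>
      obtain ⟨τ, hk⟩ := ih
      obtain ⟨-, p, hp⟩ := step' k τ hk
      refine ⟨L + p + τ, fun t ht => ?_⟩
      have := hp (t + L) ⟨by linarith [ht.1], by linarith [ht.2]⟩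
      rw [pow_succ, ← div_div]
      convert this using 5 <;> push_cast <;> ring
  have hdist : ∀ t ≥ 0, Metric.infDist (y t, y' t) (Set.range fun s => (x s, x' s))
      ≤ G * ε * (1 / 2) ^ ⌊t / L⌋₊ := by
    intro t ht
    obtain ⟨k, hk⟩ : ∃ k, k = ⌊t / L⌋₊ := ⟨_, rfl⟩
    have h1 : k * L ≤ t := by
      rw [← le_div_iff₀ hL, hk]; exact Nat.floor_le (by positivity)
    have h2 : t < (k + 1) * L := by
      rw [← div_lt_iff₀ hL, hk]; exact Nat.lt_floor_add_one _
    obtain ⟨τ, hτ⟩ := hind k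
    have h3 := (step' k τ hτ).1 (t - k * L) ⟨by linarith, by linarith⟩
    simp only [sub_add_cancel] at h3
    refine (Metric.infDist_le_dist_of_mem (Set.mem_range_self (t - k * L + τ))).trans ?_
    rw [Prod.dist_eq, Real.dist_eq, Real.dist_eq, ← hk, one_div, inv_pow, mul_assoc]
    exact max_le h3.1 h3.2
  have hlim : Tendsto (fun t : ℝ => G * ε * (1 / 2) ^ ⌊t / L⌋₊) atTop (nhds 0) := by
    have h1 : Tendsto (fun t : ℝ => ⌊t / L⌋₊) atTop atTop :=
      tendsto_nat_floor_atTop.comp (tendsto_id.atTop_div_const hL)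
    have h2 := ((tendsto_pow_atTop_nhds_zero_of_lt_one (by norm_num : (0 : ℝ) ≤ 1 / 2)
      (by norm_num)).comp h1).const_mul (G * ε)
    rwa [mul_zero] at h2
  refine ⟨fun t ht => (hdist t ht).trans_lt (lt_of_le_of_lt ?_ hGε), ?_⟩
  · exact mul_le_of_le_one_right (by positivity) (pow_le_one₀ (by norm_num) (by norm_num))
  · refine squeeze_zero' (Eventually.of_forall fun _ => Metric.infDist_nonneg) ?_ hlim
    filter_upwards [eventually_ge_atTop 0] with t ht using hdist t ht

lemma duffing_unique {u u' v v' : ℝ → ℝ} (hu : ∀ t, HasDerivAt u (u' t) t)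
    (hu' : ∀ t, HasDerivAt u' (u t - u t ^ 3) t) (hv : ∀ t, HasDerivAt v (v' t) t)
    (hv' : ∀ t, HasDerivAt v' (v t - v t ^ 3) t) {B : ℝ} (hB : ∀ t, u t ^ 2 ≤ B ∧ v t ^ 2 ≤ B)
    (h0 : u 0 = v 0) (h0' : u' 0 = v' 0) {t : ℝ} (ht : 0 ≤ t) : u t = v t := by
  have hB0 : 0 ≤ B := (sq_nonneg _).trans (hB 0).1
  have cu : Continuous u := continuous_iff_continuousAt.2 fun t => (hu t).continuousAt
  have cu' : Continuous u' := continuous_iff_continuousAt.2 fun t => (hu' t).continuousAt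
  have cv : Continuous v := continuous_iff_continuousAt.2 fun t => (hv t).continuousAt
  have cv' : Continuous v' := continuous_iff_continuousAt.2 fun t => (hv' t).continuousAt
  have key := le_of_delay_gronwall (K := 2 + 3 * B) (T := 0) (φ := 0) (m := 0) (L := t)
    (E := fun t => (u t - v t) ^ 2 + (u' t - v' t) ^ 2)
    (E' := fun t => 2 * ((u t - v t) * (u' t - v' t))
      * (2 - (u t ^ 2 + u t * v t + v t ^ 2)))
    (by positivity) le_rfl le_rfl (by fun_prop) (fun _ _ => by positivity) ?_ ?_ ?_ ⟨ht, le_rfl⟩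
  · simp only [mul_zero, zero_div, add_zero] at key
    have h1 : (u t - v t) ^ 2 = 0 :=
      le_antisymm (by nlinarith [sq_nonneg (u' t - v' t)]) (sq_nonneg _)
    exact sub_eq_zero.1 (pow_eq_zero_iff two_ne_zero |>.1 h1)
  · intro s hs
    rw [neg_zero, Set.Icc_self, Set.mem_singleton_iff] at hs
    simp [hs, h0, h0']
  · intro s _
    refine ((((hu s).fun_sub (hv s)).fun_pow 2).fun_add
      (((hu' s).fun_sub (hv' s)).fun_pow 2)).congr_deriv ?_
    push_cast
    ring
  · intro s _
    obtain ⟨b1, b2⟩ := hB s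
    have h1 : |2 * ((u s - v s) * (u' s - v' s))| ≤ (u s - v s) ^ 2 + (u' s - v' s) ^ 2 :=
      abs_le.2 ⟨by nlinarith [sq_nonneg ((u s - v s) + (u' s - v' s))],
        by nlinarith [sq_nonneg ((u s - v s) - (u' s - v' s))]⟩
    have h2 : |2 - (u s ^ 2 + u s * v s + v s ^ 2)| ≤ 2 + 3 * B :=
      abs_le.2 ⟨by nlinarith [sq_nonneg (u s - v s)], by nlinarith [sq_nonneg (u s + v s)]⟩
    refine (le_abs_self _).trans ?_
    rw [abs_mul, mul_comm, add_zero]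
    refine mul_le_mul h2 (h1.trans (le_add_of_nonneg_right (add_nonneg (sq_nonneg _) (sq_nonneg _)))) (abs_nonneg _)
      (by positivity)

lemma eq_zsmul_of_isLeast_period {f : ℝ → ℝ} {q τ : ℝ}
    (hq : IsLeast {q : ℝ | 0 < q ∧ ∀ t, f (t + q) = f t} q) (hτ : ∀ t, f (t + τ) = f t) :
    ∃ k : ℤ, τ = k * q := by
  have hq0 : 0 < q := hq.1.1
  have hper : Function.Periodic f q := hq.1.2
  have hr : Function.Periodic f (τ - ⌊τ / q⌋ * q) :=
    Function.Periodic.sub_period hτ (hper.int_mul _)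
  have h0 : 0 ≤ τ - ⌊τ / q⌋ * q := by
    have := (le_div_iff₀ hq0).1 (Int.floor_le (τ / q))
    linarith
  have h1 : τ - ⌊τ / q⌋ * q < q := by
    have := (div_lt_iff₀ hq0).1 (Int.lt_floor_add_one (τ / q))
    linarith
  refine ⟨⌊τ / q⌋, ?_⟩
  rcases h0.eq_or_lt with h | h
  · linarith
  · exact absurd (hq.2 ⟨h, hr⟩) (not_le.2 h1)

/-- A periodic solution of the double-well Duffing equation with positive energy changes sign after
half its minimal period. -/
lemma duffing_antiperiodic {x x' : ℝ → ℝ} {h q : ℝ} (hd : ∀ t, HasDerivAt x (x' t) t)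
    (hd' : ∀ t, HasDerivAt x' (x t - x t ^ 3) t)
    (hen : ∀ t, 2 * x' t ^ 2 - 2 * x t ^ 2 + x t ^ 4 = h) (hh : 0 < h)
    (hq : IsLeast {q : ℝ | 0 < q ∧ ∀ t, x (t + q) = x t} q) :
    Function.Antiperiodic x (q / 2) ∧ ∃ t, x' t = 0 := by
  have hq0 : 0 < q := hq.1.1
  have hper : Function.Periodic x q := hq.1.2
  have hc : Continuous x := continuous_iff_continuousAt.2 fun t => (hd t).continuousAt
  have hK := hper.compact_of_continuous hq0.ne' hc
  obtain ⟨_, ⟨a, rfl⟩, ha⟩ := hK.exists_isGreatest (Set.range_nonempty x)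
  obtain ⟨_, ⟨b, rfl⟩, hb⟩ := hK.exists_isLeast (Set.range_nonempty x)
  have ha' : ∀ t, x t ≤ x a := fun t => ha (Set.mem_range_self t)
  have hb' : ∀ t, x b ≤ x t := fun t => hb (Set.mem_range_self t)
  have da : x' a = 0 := IsLocalMax.hasDerivAt_eq_zero (Eventually.of_forall ha') (hd a)
  have db : x' b = 0 := IsLocalMin.hasDerivAt_eq_zero (Eventually.of_forall hb') (hd b)
  refine ⟨?_, a, da⟩
  have ea := hen a
  have eb := hen b
  rw [da] at ea
  rw [db] at eb
  have sq_gt : ∀ {z : ℝ}, 2 * (0 : ℝ) ^ 2 - 2 * z ^ 2 + z ^ 4 = h → 2 < z ^ 2 := by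
    intro z hz
    by_contra! hc
    nlinarith [mul_nonneg (sq_nonneg z) (sub_nonneg.2 hc)]
  have hsq : x a ^ 2 = x b ^ 2 := by
    have : (x a ^ 2 - x b ^ 2) * (x a ^ 2 + x b ^ 2 - 2) = 0 := by linear_combination ea - eb
    rcases mul_eq_zero.1 this with h1 | h1
    · linarith
    · linarith [sq_gt ea, sq_gt eb]
  have hab : x b = -x a := by
    rcases sq_eq_sq_iff_eq_or_eq_neg.1 hsq with h1 | h1
    · have hconst : ∀ t, x t = x a := fun t => le_antisymm (ha' t) (h1 ▸ hb' t)
      have := hq.2 (show q / 2 ∈ _ from ⟨by linarith, fun t => by rw [hconst, hconst t]⟩)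
      linarith
    · linarith
  have hbd : ∀ t, x t ^ 2 ≤ x a ^ 2 := fun t =>
    sq_le_sq' (by linarith [hb' t]) (ha' t)
  have hτ' : ∀ t, 0 ≤ t → x (t + a) = -x (t + b) := fun t ht =>
    duffing_unique (u := fun t => x (t + a)) (u' := fun t => x' (t + a))
      (v := fun t => -x (t + b)) (v' := fun t => -x' (t + b)) (B := x a ^ 2)
      (fun t => (hd _).comp_add_const t a) (fun t => (hd' _).comp_add_const t a)
      (fun t => ((hd _).comp_add_const t b).fun_neg)
      (fun t => ((hd' _).comp_add_const t b).fun_neg.congr_deriv (by ring))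
      (fun t => ⟨hbd _, by rw [neg_sq]; exact hbd _⟩) (by simp [hab]) (by simp [da, db]) ht
  have hτ : Function.Antiperiodic x (b - a) := by
    intro t
    obtain ⟨k, hk⟩ := exists_nat_gt ((a - t) / q)
    rw [div_lt_iff₀ hq0] at hk
    have h1 := hτ' (t - a + k * q) (by linarith)
    rw [show t - a + k * q + a = t + k * q by ring,
      show t - a + k * q + b = t + (b - a) + k * q by ring, hper.nat_mul k, hper.nat_mul k] at h1
    linarith
  obtain ⟨k, hk⟩ := eq_zsmul_of_isLeast_period hq hτ.periodic
  rw [two_nsmul] at hk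
  have ha0 : x a ≠ 0 := fun h0 => by have := sq_gt ea; rw [h0] at this; norm_num at this
  rcases Int.even_or_odd' k with ⟨l, rfl | rfl⟩
  · exfalso
    have h1 : b - a = l * q := by push_cast at hk; linarith
    have h2 := hτ a
    rw [h1, hper.int_mul l] at h2
    exact ha0 (by linarith)
  · have h1 : b - a = l * q + q / 2 := by push_cast at hk; linarith
    intro t
    have h2 := hτ t
    rwa [h1, ← add_assoc, add_right_comm, hper.int_mul l] at h2

/-- Orbits of small period have large energy. -/
lemma energy_large {x x' : ℝ → ℝ} {h a : ℝ} (hd : ∀ t, HasDerivAt x (x' t) t)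
    (hen : ∀ t, 2 * x' t ^ 2 - 2 * x t ^ 2 + x t ^ 4 = h) (hh : 0 < h)
    (hanti : Function.Antiperiodic x a) {t : ℝ} (ht : x' t = 0) : 16 ≤ a ^ 4 * (h + 1) := by
  obtain ⟨r, hr⟩ : ∃ r, r = Real.sqrt (h + 1) := ⟨_, rfl⟩
  have hr0 : 0 < r := hr ▸ Real.sqrt_pos.2 (by linarith)
  have hr2 : r ^ 2 = h + 1 := hr ▸ Real.sq_sqrt (by linarith)
  have et := hen t
  rw [ht] at et
  have hxr : r ≤ x t ^ 2 := by
    have h2 : 2 < x t ^ 2 := by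
      by_contra! hc
      nlinarith [mul_nonneg (sq_nonneg (x t)) (sub_nonneg.2 hc)]
    have : r ^ 2 = (x t ^ 2 - 1) ^ 2 := by linear_combination hr2 - et
    nlinarith [abs_le_of_sq_le_sq this.le (by linarith), le_abs_self r]
  have hb : ∀ s, ‖x' s‖ ≤ r := fun s => by
    refine abs_le_of_sq_le_sq ?_ hr0.le
    nlinarith [hen s, sq_nonneg (x s ^ 2 - 1), sq_nonneg (x' s)]
  have hm := (convex_univ (𝕜 := ℝ) (E := ℝ)).norm_image_sub_le_of_norm_hasDerivWithin_le
    (fun u _ => (hd u).hasDerivWithinAt) (fun u _ => hb u) (Set.mem_univ t) (Set.mem_univ (t + a))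
  rw [hanti t, add_sub_cancel_left, Real.norm_eq_abs, Real.norm_eq_abs] at hm
  have h1 := pow_le_pow_left₀ (abs_nonneg _) hm 2
  rw [mul_pow, sq_abs, sq_abs] at h1
  have h2 : 4 ≤ r * a ^ 2 := by
    have : r * 4 ≤ r * (r * a ^ 2) := by nlinarith
    exact le_of_mul_le_mul_left this hr0
  calc (16 : ℝ) = 4 ^ 2 := by norm_num
    _ ≤ (r * a ^ 2) ^ 2 := by gcongr
    _ = a ^ 4 * (h + 1) := by rw [← hr2]; ring

lemma isDelayedDuffing_clip {T : ℝ} (hT : 0 < T) {y : ℝ → ℝ}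
    (hy1 : ∀ t ∈ Set.Ici (-T), DifferentiableAt ℝ y t) (hy2 : ContinuousOn (deriv y) (Set.Ici (-T)))
    (hy3 : ∀ t ∈ Set.Ioi (0 : ℝ), DifferentiableAt ℝ (deriv y) t)
    (hy4 : ∀ t ∈ Set.Ioi (0 : ℝ), deriv (deriv y) t + y (t - T) + (y t) ^ 3 = 0) :
    IsDelayedDuffing T (fun t => y (max t (-T))) (fun t => deriv y (max t (-T))) := by
  have hc : Continuous fun t : ℝ => max t (-T) := by fun_prop
  have hmem : ∀ t : ℝ, max t (-T) ∈ Set.Ici (-T) := fun t => Set.mem_Ici.2 (le_max_right _ _)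
  have heq : ∀ t > 0, ∀ f : ℝ → ℝ, (fun t => f (max t (-T))) =ᶠ[nhds t] f := fun t ht f => by
    filter_upwards [eventually_gt_nhds (by linarith : -T < t)] with s hs
    rw [max_eq_left hs.le]
  refine ⟨?_, hy2.comp_continuous hc hmem, fun t ht => ?_, fun t ht => ?_⟩
  · exact ContinuousOn.comp_continuous
      (fun t ht => (hy1 t ht).continuousAt.continuousWithinAt) hc hmem
  · refine HasDerivAt.congr_of_eventuallyEq ?_ (heq t ht y)
    rw [max_eq_left (by linarith)]
    exact (hy1 t (show -T ≤ t by linarith)).hasDerivAt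
  · refine HasDerivAt.congr_of_eventuallyEq ?_ (heq t ht (deriv y))
    rw [max_eq_left (by linarith), max_eq_left (by linarith)]
    exact (hy3 t ht).hasDerivAt.congr_deriv (by linarith [hy4 t ht])

lemma exists_isDuffingOrbit {T : ℝ} {n : ℕ} (hn : Odd n) {x : ℝ → ℝ}
    (hx1 : Differentiable ℝ x) (hx2 : Differentiable ℝ (deriv x))
    (hode : ∀ t : ℝ, deriv (deriv x) t - x t + (x t) ^ 3 = 0)
    (hpos : ∀ t : ℝ, 0 < (1/2) * (deriv x t) ^ 2 - (1/2) * (x t) ^ 2 + (1/4) * (x t) ^ 4)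
    (hq : IsLeast {q : ℝ | 0 < q ∧ ∀ t : ℝ, x (t + q) = x t} (2 * T / n)) :
    ∃ h, IsDuffingOrbit T h x (deriv x) ∧ 16 ≤ (T / n) ^ 4 * (h + 1) := by
  have hd : ∀ t, HasDerivAt x (deriv x t) t := fun t => (hx1 t).hasDerivAt
  have hd' : ∀ t, HasDerivAt (deriv x) (x t - x t ^ 3) t := fun t =>
    (hx2 t).hasDerivAt.congr_deriv (by linarith [hode t])
  have hE : ∀ t, HasDerivAt (fun t => 2 * deriv x t ^ 2 - 2 * x t ^ 2 + x t ^ 4) 0 t := fun t =>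
    ((((hd' t).fun_pow 2).const_mul 2).fun_sub (((hd t).fun_pow 2).const_mul 2)).fun_add
      ((hd t).fun_pow 4) |>.congr_deriv (by push_cast; ring)
  obtain ⟨h, hh⟩ : ∃ h, h = 2 * deriv x 0 ^ 2 - 2 * x 0 ^ 2 + x 0 ^ 4 := ⟨_, rfl⟩
  have hen : ∀ t, 2 * deriv x t ^ 2 - 2 * x t ^ 2 + x t ^ 4 = h := fun t =>
    (is_const_of_deriv_eq_zero (fun t => (hE t).differentiableAt) (fun t => (hE t).deriv) t 0).trans
      hh.symm
  have hh0 : 0 < h := by rw [hh]; linarith [hpos 0]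
  have hn0 : (n : ℝ) ≠ 0 := by exact_mod_cast hn.pos.ne'
  obtain ⟨ha, t₀, ht₀⟩ := duffing_antiperiodic hd hd' hen hh0 hq
  rw [mul_div_assoc, mul_div_cancel_left₀ _ (two_ne_zero' ℝ)] at ha
  have haT : Function.Antiperiodic x T := by
    obtain ⟨k, rfl⟩ := hn
    have h1 := ha.odd_nsmul_antiperiodic k
    rwa [nsmul_eq_mul, mul_div_cancel₀ _ hn0] at h1
  have hxT : ∀ t, x (t - T) = -x t := haT.sub_eq
  refine ⟨h, ⟨hd, hd', hen, hxT, fun t => ?_⟩, energy_large hd hen hh0 ha ht₀⟩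
  have h1 := (hd (t - T)).comp_sub_const t T
  have h2 : (fun t => x (t - T)) = fun t => -x t := funext hxT
  rw [h2] at h1
  exact h1.unique (hd t).fun_neg

theorem delayedDuffing_odd_stability (T : ℝ) (hT : 0 < T)
    (hT2 : T ^ 2 < 3 / 2 * Real.pi ^ 2) :
    ∃ n₀ : ℕ, ∀ n : ℕ, Odd n → n₀ ≤ n →
      ∀ x : ℝ → ℝ,
        Differentiable ℝ x → Differentiable ℝ (deriv x) →
        (∀ t : ℝ, deriv (deriv x) t - x t + (x t) ^ 3 = 0) →
        (∀ t : ℝ, 0 < (1/2) * (deriv x t) ^ 2 - (1/2) * (x t) ^ 2 + (1/4) * (x t) ^ 4) →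
        IsLeast {q : ℝ | 0 < q ∧ ∀ t : ℝ, x (t + q) = x t} (2 * T / n) →
        ∀ δ > (0:ℝ), ∃ ε > (0:ℝ), ∀ y : ℝ → ℝ,
          (∀ t ∈ Set.Ici (-T), DifferentiableAt ℝ y t) →
          ContinuousOn (deriv y) (Set.Ici (-T)) →
          (∀ t ∈ Set.Ioi (0:ℝ), DifferentiableAt ℝ (deriv y) t) →
          (∀ t ∈ Set.Ioi (0:ℝ), deriv (deriv y) t + y (t - T) + (y t) ^ 3 = 0) →
          (∃ θ : ℝ, ∀ s ∈ Set.Icc (-T) (0:ℝ),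
            |y s - x (s + θ)| + |deriv y s - deriv x (s + θ)| < ε) →
          (∀ t ≥ (0:ℝ),
            Metric.infDist (y t, deriv y t)
              (Set.range fun s : ℝ => (x s, deriv x s)) < δ) ∧
          Tendsto
            (fun t : ℝ => Metric.infDist (y t, deriv y t)
              (Set.range fun s : ℝ => (x s, deriv x s)))
            atTop (nhds 0) := by
  obtain ⟨s, hs, hs1, key⟩ := exists_orbitally_stable hT hT2
  obtain ⟨n₀, hn₀⟩ := exists_nat_ge (T / s)
  refine ⟨n₀, fun n hn hnn x hx1 hx2 hode hpos hq δ hδ => ?_⟩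
  obtain ⟨h, hx, hlarge⟩ := exists_isDuffingOrbit hn hx1 hx2 hode hpos hq
  have hn0 : (0 : ℝ) < n := by exact_mod_cast hn.pos
  have hTn : T / n ≤ s := by
    have h1 : T / s ≤ n := hn₀.trans (by exact_mod_cast hnn)
    rw [div_le_iff₀ hs] at h1
    rw [div_le_iff₀ hn0]
    linarith
  have hh0 : 0 < h + 1 := pos_of_mul_pos_right (by linarith) (by positivity : 0 ≤ (T / n) ^ 4)
  obtain ⟨ε, hε, stab⟩ := key h ((div_le_iff₀' (by positivity)).2
    (hlarge.trans (by gcongr))) δ hδ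
  refine ⟨ε, hε, fun y hy1 hy2 hy3 hy4 ⟨θ, hθ⟩ => ?_⟩
  obtain ⟨h1, h2⟩ := stab _ _ _ _ (hx.translate θ) (isDelayedDuffing_clip hT hy1 hy2 hy3 hy4)
    fun t ht => by
      simp only [max_eq_left ht.1]
      exact (hθ t ht).le
  have hrange : (Set.range fun s => (x (s + θ), deriv x (s + θ)))
      = Set.range fun s => (x s, deriv x s) :=
    (Equiv.addRight θ).surjective.range_comp fun s => (x s, deriv x s)
  rw [hrange] at h1 h2
  have hmax : ∀ t ≥ 0, max t (-T) = t := fun t ht => max_eq_left (by linarith)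
  refine ⟨fun t ht => by simpa only [hmax t ht] using h1 t ht, h2.congr' ?_⟩
  filter_upwards [eventually_ge_atTop 0] with t ht
  rw [hmax t ht]
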